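/- Fix a constant C ≥ 1. There exist ε > 0 and δ_0 > 0 such that for all δ ∈ (0,δ_0) the following holds. Let A ⊆ [1/C, C] ∪ [−C, −1/C] be a compact (δ,1/2)_1 set with constant C satisfying vol(A) ≥ δ^{1/2+ε} (note that automatically vol(A) ≤ C²·δ^{1/2}). Then vol(A − A) ≥ δ^{1/2−ε} or vol(A·A) ≥ δ^{1/2−ε}, where A − A = { a − a' : a, a' ∈ A } and A·A = { a·a' : a, a' ∈ A }. -/

import Mathlib

open MeasureTheory Metric Set
open scoped ENNReal

noncomputable section

/-- `A ⊆ ℝ` is a `(δ,ρ)_1` set with constant `C`. -/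
def IsDeltaRhoSet1 (δ ρ C : ℝ) (A : Set ℝ) : Prop :=
  ∀ (x r : ℝ), δ ≤ r →
    volume (A ∩ closedBall x r) ≤ ENNReal.ofReal (C * δ ^ (1 - ρ) * r ^ ρ)

open scoped Pointwise

/-- A finite set of reals, separated well enough for its elements and those of its dilates to be
told apart at scale `ρ`, which has small difference and product sets at scale `ρ` and
which is non-concentrated at all scales `r ≥ δ`. -/
structure IsAlmostRing (ρ δ K : ℝ) (P : Finset ℝ) : Prop where
  le_K : 100 ≤ K
  rho_pos : 0 < ρ
  rho_le : ρ ≤ δ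
  nonempty : P.Nonempty
  one_le : ∀ p ∈ P, 1 ≤ K * |p|
  abs_bound : ∀ p ∈ P, |p| ≤ K
  sep_dilate : ∀ a ∈ P, ∀ p ∈ P, ∀ q ∈ P, p ≠ q → ρ ≤ |a| * |p - q|
  sep : ∀ p ∈ P, ∀ q ∈ P, p ≠ q → 2 * ρ ≤ |p - q|
  frost : ∀ x r : ℝ, δ ≤ r → ((P.filter fun p => |p - x| ≤ r).card : ℝ) ≤ K * P.card * √r
  diff : (((P ×ˢ P).image fun z => ⌊(z.1 - z.2) / ρ⌋).card : ℝ) ≤ K * P.card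
  prod : (((P ×ˢ P).image fun z => ⌊z.1 * z.2 / ρ⌋).card : ℝ) ≤ K * P.card

/-- The dilate `a • P` discretized at scale `ρ`. -/
def dilate (ρ : ℝ) (P : Finset ℝ) (a : ℝ) : Finset ℤ := P.image fun p => ⌊a * p / ρ⌋

lemma abs_sub_lt_of_floor_eq {x y : ℝ} (h : ⌊x⌋ = ⌊y⌋) : |x - y| < 1 :=
  Int.abs_sub_lt_one_of_floor_eq_floor h

namespace IsAlmostRing

variable {ρ δ K : ℝ} {P : Finset ℝ}

lemma K_pos (h : IsAlmostRing ρ δ K P) : 0 < K := by linarith [h.le_K]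

lemma card_pos (h : IsAlmostRing ρ δ K P) : (0 : ℝ) < P.card := by
  exact_mod_cast h.nonempty.card_pos

lemma card_dilate (h : IsAlmostRing ρ δ K P) {a : ℝ} (ha : a ∈ P) :
    (dilate ρ P a).card = P.card := by
  apply Finset.card_image_of_injOn
  intro p hp q hq hpq
  by_contra hne
  have h1 := abs_sub_lt_of_floor_eq hpq
  have h2 := h.sep_dilate a ha p hp q hq hne
  have hρ := h.rho_pos
  rw [← sub_div, ← mul_sub, abs_div, abs_of_pos hρ, div_lt_one hρ, abs_mul] at h1
  linarith

lemma card_dilate_sub_self (h : IsAlmostRing ρ δ K P) {a : ℝ} (ha : a ∈ P) :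
    ((dilate ρ P a - dilate ρ P a).card : ℝ) ≤ 3 * K ^ 2 * P.card := by
  set D := (P ×ˢ P).image fun z => ⌊(z.1 - z.2) / ρ⌋ with hD
  set k : ℤ := ⌈K⌉ + 2 with hk
  have hK := h.le_K
  have hsub : dilate ρ P a - dilate ρ P a ⊆
      (D.image fun d : ℤ => ⌊a * d⌋) + Finset.Icc (-k) k := by
    intro z hz
    obtain ⟨x, hx, y, hy, rfl⟩ := Finset.mem_sub.1 hz
    obtain ⟨p, hp, rfl⟩ := Finset.mem_image.1 hx
    obtain ⟨q, hq, rfl⟩ := Finset.mem_image.1 hy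
    set d := ⌊(p - q) / ρ⌋ with hd
    have hdD : d ∈ D := Finset.mem_image.2 ⟨(p, q), by simp [hp, hq], rfl⟩
    refine Finset.mem_add.2 ⟨⌊a * d⌋, Finset.mem_image_of_mem _ hdD,
      ⌊a * p / ρ⌋ - ⌊a * q / ρ⌋ - ⌊a * d⌋, ?_, by ring⟩
    have e1 := Int.floor_le (a * p / ρ)
    have e2 := Int.lt_floor_add_one (a * p / ρ)
    have e3 := Int.floor_le (a * q / ρ)
    have e4 := Int.lt_floor_add_one (a * q / ρ)
    have e5 := Int.floor_le (a * d)
    have e6 := Int.lt_floor_add_one (a * d)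
    have e7 := Int.floor_le ((p - q) / ρ)
    have e8 := Int.lt_floor_add_one ((p - q) / ρ)
    have e9 : |a * ((p - q) / ρ - d)| ≤ K := by
      rw [abs_mul, abs_of_nonneg (by linarith : 0 ≤ (p - q) / ρ - (d : ℝ))]
      nlinarith [h.abs_bound a ha, abs_nonneg a]
    have e10 : a * p / ρ - a * q / ρ = a * ((p - q) / ρ) := by ring
    have e11 := Int.le_ceil K
    rw [abs_le] at e9
    rw [Finset.mem_Icc]
    constructor
    · have : (-(k : ℝ)) < (⌊a * p / ρ⌋ - ⌊a * q / ρ⌋ - ⌊a * d⌋ : ℤ) + 1 := by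
        push_cast [hk]; nlinarith
      exact_mod_cast Int.lt_add_one_iff.1 (by exact_mod_cast this)
    · have : ((⌊a * p / ρ⌋ - ⌊a * q / ρ⌋ - ⌊a * d⌋ : ℤ) : ℝ) < k + 1 := by
        push_cast [hk]; nlinarith
      exact Int.lt_add_one_iff.1 (by exact_mod_cast this)
  have hk0 : 0 ≤ k := by
    have : (0 : ℤ) ≤ ⌈K⌉ := Int.ceil_nonneg (by linarith)
    omega
  have c1 : ((Finset.Icc (-k) k).card : ℝ) ≤ 3 * K := by
    rw [Int.card_Icc]
    have : (((k + 1 - -k).toNat : ℤ) : ℝ) = k + 1 + k := by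
      rw [Int.toNat_of_nonneg (by omega)]; push_cast; ring
    rw [← Int.cast_natCast, this, hk]; push_cast
    linarith [Int.ceil_lt_add_one K]
  have c2 : ((D.image fun d : ℤ => ⌊a * d⌋).card : ℝ) ≤ K * P.card :=
    le_trans (by exact_mod_cast Finset.card_image_le) h.diff
  calc ((dilate ρ P a - dilate ρ P a).card : ℝ)
      ≤ ((D.image fun d : ℤ => ⌊a * d⌋).card * (Finset.Icc (-k) k).card : ℕ) := by
        exact_mod_cast (Finset.card_le_card hsub).trans (Finset.card_add_le)
    _ ≤ (K * P.card) * (3 * K) := by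
        push_cast
        exact mul_le_mul c2 c1 (by positivity) (by have := h.K_pos; positivity)
    _ = _ := by ring

lemma exists_pivot (h : IsAlmostRing ρ δ K P) :
    ∃ b ∈ P, (P.card : ℝ) ^ 2 ≤
      K * ∑ a ∈ P, ((dilate ρ P a ∩ dilate ρ P b).card : ℝ) := by
  classical
  set M := (P ×ˢ P).image fun z => ⌊z.1 * z.2 / ρ⌋ with hM
  have hsub : ∀ a ∈ P, dilate ρ P a ⊆ M := by
    intro a ha x hx
    obtain ⟨p, hp, rfl⟩ := Finset.mem_image.1 hx
    exact Finset.mem_image.2 ⟨(a, p), by simp [ha, hp], rfl⟩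
  have hsum : ∀ s ⊆ M, (s.card : ℝ) = ∑ m ∈ M, if m ∈ s then 1 else 0 := by
    intro s hs
    rw [Finset.sum_ite_mem, Finset.inter_eq_right.2 hs]; simp
  have h1 : (∑ m ∈ M, ∑ a ∈ P, if m ∈ dilate ρ P a then (1 : ℝ) else 0)
      = (P.card : ℝ) ^ 2 := by
    rw [Finset.sum_comm, Finset.sum_congr rfl (g := fun _ => (P.card : ℝ))]
    · simp [sq]
    · intro a ha
      rw [← hsum _ (hsub a ha), h.card_dilate ha]
  have h2 : ∑ m ∈ M, (∑ a ∈ P, if m ∈ dilate ρ P a then (1 : ℝ) else 0) ^ 2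
      = ∑ b ∈ P, ∑ a ∈ P, ((dilate ρ P a ∩ dilate ρ P b).card : ℝ) := by
    simp_rw [sq, Finset.sum_mul_sum]
    rw [Finset.sum_comm]
    refine Finset.sum_congr rfl fun b hb => ?_
    rw [Finset.sum_comm]
    refine Finset.sum_congr rfl fun a ha => ?_
    rw [hsum _ (Finset.inter_subset_left.trans (hsub a ha))]
    refine Finset.sum_congr rfl fun m _ => ?_
    by_cases h1 : m ∈ dilate ρ P a <;> by_cases h2 : m ∈ dilate ρ P b <;> simp [h1, h2]
  have h3 := sq_sum_le_card_mul_sum_sq (s := M)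
    (f := fun m => ∑ a ∈ P, if m ∈ dilate ρ P a then (1 : ℝ) else 0)
  rw [h1, h2] at h3
  by_contra! hcon
  have hN := h.card_pos
  have h4 : K * ∑ b ∈ P, ∑ a ∈ P, ((dilate ρ P a ∩ dilate ρ P b).card : ℝ)
      < (P.card : ℝ) ^ 3 := by
    rw [Finset.mul_sum]
    calc _ < ∑ b ∈ P, (P.card : ℝ) ^ 2 := Finset.sum_lt_sum_of_nonempty h.nonempty hcon
      _ = _ := by rw [Finset.sum_const, nsmul_eq_mul]; ring
  have h5 : (0:ℝ) ≤ ∑ b ∈ P, ∑ a ∈ P, ((dilate ρ P a ∩ dilate ρ P b).card : ℝ) :=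
    Finset.sum_nonneg fun _ _ => Finset.sum_nonneg fun _ _ => Nat.cast_nonneg _
  generalize (∑ b ∈ P, ∑ a ∈ P, ((dilate ρ P a ∩ dilate ρ P b).card : ℝ)) = S at h3 h4 h5
  have h6 := mul_le_mul_of_nonneg_right h.prod h5
  have h7 := mul_lt_mul_of_pos_left h4 hN
  have h8 : K * P.card * S = P.card * (K * S) := by ring
  have h9 : ((P.card : ℝ) ^ 2) ^ 2 = P.card * (P.card : ℝ) ^ 3 := by ring
  linarith

/-- The Katz–Tao lemma: for many `a ∈ P` the set `b • P - a • P` is small. -/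
lemma exists_refinement (h : IsAlmostRing ρ δ K P) :
    ∃ b ∈ P, ∃ Q ⊆ P, (P.card : ℝ) ≤ 2 * K * Q.card ∧
      ∀ a ∈ Q, ((dilate ρ P b - dilate ρ P a).card : ℝ) ≤ K ^ 6 * P.card := by
  classical
  obtain ⟨b, hb, hsum⟩ := h.exists_pivot
  have hK := h.le_K
  have hN := h.card_pos
  refine ⟨b, hb, P.filter fun a => (P.card : ℝ) ≤ 2 * K * (dilate ρ P a ∩ dilate ρ P b).card,
    Finset.filter_subset _ _, ?_, ?_⟩
  · set Q := P.filter fun a => (P.card : ℝ) ≤ 2 * K * (dilate ρ P a ∩ dilate ρ P b).card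
    have h1 : ∀ a ∈ P, 2 * K * ((dilate ρ P a ∩ dilate ρ P b).card : ℝ) ≤
        P.card + if (P.card : ℝ) ≤ 2 * K * (dilate ρ P a ∩ dilate ρ P b).card
          then 2 * K * (P.card : ℝ) else 0 := by
      intro a ha
      split_ifs with hc
      · have : ((dilate ρ P a ∩ dilate ρ P b).card : ℝ) ≤ P.card := by
          rw [← h.card_dilate ha]; exact_mod_cast Finset.card_le_card Finset.inter_subset_left
        nlinarith
      · push Not at hc; linarith
    have h2 := Finset.sum_le_sum h1
    rw [Finset.sum_add_distrib, ← Finset.sum_filter, ← Finset.mul_sum] at h2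
    simp only [Finset.sum_const, nsmul_eq_mul] at h2
    have h3 : (P.card : ℝ) * P.card ≤ (2 * K * Q.card) * P.card := by nlinarith
    exact le_of_mul_le_mul_right h3 hN
  · intro a ha
    rw [Finset.mem_filter] at ha
    obtain ⟨ha, hc⟩ := ha
    set Y := dilate ρ P a ∩ dilate ρ P b
    have h1 := Finset.ruzsa_triangle_inequality_sub_sub_sub (dilate ρ P b) Y (dilate ρ P a)
    have h2 : ((dilate ρ P b - Y).card : ℝ) ≤ 3 * K ^ 2 * P.card :=
      (Nat.cast_le.2 (Finset.card_le_card (Finset.sub_subset_sub_left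
        Finset.inter_subset_right))).trans (h.card_dilate_sub_self hb)
    have h3 : ((dilate ρ P a - Y).card : ℝ) ≤ 3 * K ^ 2 * P.card :=
      (Nat.cast_le.2 (Finset.card_le_card (Finset.sub_subset_sub_left
        Finset.inter_subset_left))).trans (h.card_dilate_sub_self ha)
    have h4 : ((dilate ρ P b - dilate ρ P a).card : ℝ) * Y.card ≤
        (3 * K ^ 2 * P.card) * (3 * K ^ 2 * P.card) :=
      le_trans (by exact_mod_cast h1) (mul_le_mul h2 h3 (by positivity) (by positivity))
    have h5 : ((dilate ρ P b - dilate ρ P a).card : ℝ) * P.card ≤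
        18 * K ^ 5 * P.card * P.card := by
      calc _ ≤ ((dilate ρ P b - dilate ρ P a).card : ℝ) * (2 * K * Y.card) := by gcongr
        _ = (2 * K) * (((dilate ρ P b - dilate ρ P a).card : ℝ) * Y.card) := by ring
        _ ≤ (2 * K) * ((3 * K ^ 2 * P.card) * (3 * K ^ 2 * P.card)) := by gcongr
        _ = _ := by ring
    have h6 := le_of_mul_le_mul_right h5 hN
    refine h6.trans ?_
    gcongr
    rw [pow_succ K 5]
    nlinarith [pow_pos h.K_pos 5]

/-- A Plünnecke bound for combinations of the dilates of `P` by elements of a refinement. -/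
lemma card_nsmul_sub_nsmul (h : IsAlmostRing ρ δ K P) {b : ℝ} (hb : b ∈ P) {Q : Finset ℝ}
    (hQ : ∀ a ∈ Q, ((dilate ρ P b - dilate ρ P a).card : ℝ) ≤ K ^ 6 * P.card)
    {a₁ a₂ a₃ a₄ : ℝ} (h₁ : a₁ ∈ Q) (h₂ : a₂ ∈ Q) (h₃ : a₃ ∈ Q) (h₄ : a₄ ∈ Q) (m n : ℕ) :
    let B := dilate ρ P b ∪ (dilate ρ P a₁ ∪ (dilate ρ P a₂ ∪ (dilate ρ P a₃ ∪ dilate ρ P a₄)))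
    ((m • B - n • B).card : ℝ) ≤ (K ^ 7) ^ (m + n) * P.card := by
  classical
  intro B
  have hK := h.le_K
  have hN := h.card_pos
  have hne : (dilate ρ P b).Nonempty := h.nonempty.image _
  have h1 := Finset.pluennecke_ruzsa_inequality_nsmul_sub_nsmul_sub hne B m n
  rw [h.card_dilate hb] at h1
  have h2 : ((m • B - n • B).card : ℝ) ≤
      (((dilate ρ P b - B).card : ℝ) / P.card) ^ (m + n) * P.card := by
    have := (NNRat.cast_le (K := ℝ)).2 h1
    push_cast at this
    exact this
  have hb' : ((dilate ρ P b - dilate ρ P b).card : ℝ) ≤ K ^ 6 * P.card := by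
    refine (h.card_dilate_sub_self hb).trans ?_
    gcongr
    have : (1 : ℝ) ≤ K ^ 3 := one_le_pow₀ (by linarith)
    nlinarith [pow_pos h.K_pos 2, pow_pos h.K_pos 3, pow_pos h.K_pos 5]
  have h3 : ((dilate ρ P b - B).card : ℝ) ≤ K ^ 7 * P.card := by
    have : (dilate ρ P b - B).card ≤ (dilate ρ P b - dilate ρ P b).card +
        ((dilate ρ P b - dilate ρ P a₁).card + ((dilate ρ P b - dilate ρ P a₂).card +
        ((dilate ρ P b - dilate ρ P a₃).card + (dilate ρ P b - dilate ρ P a₄).card))) := by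
      simp only [B, Finset.sub_union]
      refine (Finset.card_union_le _ _).trans (Nat.add_le_add_left ?_ _)
      refine (Finset.card_union_le _ _).trans (Nat.add_le_add_left ?_ _)
      refine (Finset.card_union_le _ _).trans (Nat.add_le_add_left ?_ _)
      exact Finset.card_union_le _ _
    have this' : ((dilate ρ P b - B).card : ℝ) ≤ (dilate ρ P b - dilate ρ P b).card +
        ((dilate ρ P b - dilate ρ P a₁).card + ((dilate ρ P b - dilate ρ P a₂).card +
        ((dilate ρ P b - dilate ρ P a₃).card + (dilate ρ P b - dilate ρ P a₄).card))) := by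
      exact_mod_cast this
    have h5 : 5 * (K ^ 6 * P.card) ≤ K ^ 7 * P.card := by
      have := mul_le_mul_of_nonneg_right (show 5 ≤ K by linarith)
        (by positivity : 0 ≤ K ^ 6 * (P.card : ℝ))
      calc _ ≤ _ := this
        _ = _ := by ring
    linarith [hQ _ h₁, hQ _ h₂, hQ _ h₃, hQ _ h₄]
  refine h2.trans ?_
  gcongr
  rwa [div_le_iff₀ hN]

end IsAlmostRing

lemma exists_separated_subset (P : Finset ℝ) {d : ℝ} (hd : 0 ≤ d) :
    ∃ S ⊆ P, (∀ x ∈ S, ∀ y ∈ S, x ≠ y → d < |x - y|) ∧ ∀ p ∈ P, ∃ x ∈ S, |p - x| ≤ d := by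
  classical
  induction P using Finset.induction_on with
  | empty => exact ⟨∅, by simp⟩
  | insert a s _ ih =>
    obtain ⟨S, hS, hsep, hcov⟩ := ih
    by_cases hc : ∃ x ∈ S, |a - x| ≤ d
    · refine ⟨S, hS.trans (Finset.subset_insert _ _), hsep, fun p hp => ?_⟩
      rcases Finset.mem_insert.1 hp with rfl | hp
      exacts [hc, hcov p hp]
    · push Not at hc
      refine ⟨insert a S, Finset.insert_subset_insert _ hS, ?_, fun p hp => ?_⟩
      · intro x hx y hy hxy
        rcases Finset.mem_insert.1 hx with hxa | hxS <;>
          rcases Finset.mem_insert.1 hy with hya | hyS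
        · exact absurd (hxa.trans hya.symm) hxy
        · rw [hxa]; exact hc y hyS
        · rw [hya, abs_sub_comm]; exact hc x hxS
        · exact hsep x hxS y hyS hxy
      · rcases Finset.mem_insert.1 hp with rfl | hp
        · exact ⟨p, Finset.mem_insert_self _ _, by simpa using hd⟩
        · obtain ⟨x, hx, h⟩ := hcov p hp
          exact ⟨x, Finset.mem_insert_of_mem hx, h⟩

lemma card_le_card_mul_of_cover {P S : Finset ℝ} {d m : ℝ}
    (hcov : ∀ p ∈ P, ∃ x ∈ S, |p - x| ≤ d)
    (hm : ∀ x ∈ S, ((P.filter fun p => |p - x| ≤ d).card : ℝ) ≤ m) :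
    (P.card : ℝ) ≤ S.card * m := by
  classical
  have h1 : P ⊆ S.biUnion fun x => P.filter fun p => |p - x| ≤ d := by
    intro p hp
    obtain ⟨x, hx, h⟩ := hcov p hp
    exact Finset.mem_biUnion.2 ⟨x, hx, Finset.mem_filter.2 ⟨hp, h⟩⟩
  calc (P.card : ℝ) ≤ ∑ x ∈ S, ((P.filter fun p => |p - x| ≤ d).card : ℝ) := by
        exact_mod_cast (Finset.card_le_card h1).trans Finset.card_biUnion_le
    _ ≤ ∑ x ∈ S, m := Finset.sum_le_sum hm
    _ = _ := by simp

lemma card_sq_le_card_image_mul {α β : Type*} [DecidableEq β] (s : Finset α) (f : α → β) :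
    (s.card : ℝ) ^ 2 ≤
      (s.image f).card * ((s ×ˢ s).filter fun z => f z.1 = f z.2).card := by
  classical
  have h1 : (s.card : ℝ) = ∑ b ∈ s.image f, ((s.filter fun a => f a = b).card : ℝ) := by
    exact_mod_cast Finset.card_eq_sum_card_image f s
  have h2 : (((s ×ˢ s).filter fun z => f z.1 = f z.2).card : ℝ) =
      ∑ b ∈ s.image f, ((s.filter fun a => f a = b).card : ℝ) ^ 2 := by
    have hm : Set.MapsTo (fun z : α × α => f z.1)
        ((s ×ˢ s).filter fun z => f z.1 = f z.2 : Finset (α × α)) (s.image f : Finset β) := by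
      intro z hz
      have := (Finset.mem_product.1 (Finset.mem_filter.1 hz).1).1
      exact Finset.mem_image_of_mem _ this
    rw [Finset.card_eq_sum_card_fiberwise hm]
    push_cast
    refine Finset.sum_congr rfl fun b _ => ?_
    rw [sq, ← Nat.cast_mul, ← Finset.card_product]
    congr 2
    ext ⟨x, y⟩
    simp only [Finset.mem_filter, Finset.mem_product]
    constructor
    · rintro ⟨⟨⟨hx, hy⟩, hxy⟩, rfl⟩
      exact ⟨⟨hx, rfl⟩, hy, hxy.symm⟩
    · rintro ⟨⟨hx, rfl⟩, hy, hxy⟩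
      exact ⟨⟨⟨hx, hy⟩, hxy.symm⟩, rfl⟩
  rw [h2]
  nth_rewrite 1 [h1]
  exact sq_sum_le_card_mul_sum_sq

/-- The number of solutions of `|p - p' - y (q - q')| ≤ w` in `P`. -/
def energy (P : Finset ℝ) (y w : ℝ) : ℕ :=
  (((P ×ˢ P) ×ˢ (P ×ˢ P)).filter fun z =>
    |z.1.1 - z.2.1 - y * (z.1.2 - z.2.2)| ≤ w).card

lemma floor_mul_bounds {ρ : ℝ} (hρ : 0 < ρ) (x : ℝ) :
    ρ * ⌊x / ρ⌋ ≤ x ∧ x < ρ * ⌊x / ρ⌋ + ρ := by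
  have h1 := Int.floor_le (x / ρ)
  have h2 := Int.lt_floor_add_one (x / ρ)
  rw [le_div_iff₀ hρ] at h1
  rw [div_lt_iff₀ hρ] at h2
  constructor <;> linarith

lemma abs_sub_le_of_floor_eq {ρ x₁ x₂ x₃ x₄ x₅ y₁ y₂ y₃ y₄ y₅ : ℝ} (hρ : 0 < ρ)
    (h : ⌊x₁ / ρ⌋ + ⌊x₂ / ρ⌋ + ⌊x₃ / ρ⌋ - (⌊x₄ / ρ⌋ + ⌊x₅ / ρ⌋) =
      ⌊y₁ / ρ⌋ + ⌊y₂ / ρ⌋ + ⌊y₃ / ρ⌋ - (⌊y₄ / ρ⌋ + ⌊y₅ / ρ⌋)) :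
    |(x₁ + x₂ + x₃ - (x₄ + x₅)) - (y₁ + y₂ + y₃ - (y₄ + y₅))| ≤ 5 * ρ := by
  have bound : ∀ z₁ z₂ z₃ z₄ z₅ : ℝ,
      -(2 * ρ) ≤ z₁ + z₂ + z₃ - (z₄ + z₅) -
        ρ * ((⌊z₁ / ρ⌋ + ⌊z₂ / ρ⌋ + ⌊z₃ / ρ⌋ - (⌊z₄ / ρ⌋ + ⌊z₅ / ρ⌋) : ℤ) : ℝ) ∧
      z₁ + z₂ + z₃ - (z₄ + z₅) -
        ρ * ((⌊z₁ / ρ⌋ + ⌊z₂ / ρ⌋ + ⌊z₃ / ρ⌋ - (⌊z₄ / ρ⌋ + ⌊z₅ / ρ⌋) : ℤ) : ℝ) ≤ 3 * ρ := by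
    intro z₁ z₂ z₃ z₄ z₅
    obtain ⟨a1, b1⟩ := floor_mul_bounds hρ z₁
    obtain ⟨a2, b2⟩ := floor_mul_bounds hρ z₂
    obtain ⟨a3, b3⟩ := floor_mul_bounds hρ z₃
    obtain ⟨a4, b4⟩ := floor_mul_bounds hρ z₄
    obtain ⟨a5, b5⟩ := floor_mul_bounds hρ z₅
    push_cast
    simp only [mul_add, mul_sub]
    constructor <;> linarith
  have hx := bound x₁ x₂ x₃ x₄ x₅
  have hy := bound y₁ y₂ y₃ y₄ y₅
  rw [h] at hx
  rw [abs_le]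
  constructor <;> linarith [hx.1, hx.2, hy.1, hy.2]

lemma cube_le_of_cauchy_schwarz {s N K E τ : ℝ} (hs : 0 < s) (hN : 0 < N) (hK : 0 < K)
    (hτ : 0 ≤ τ) (h : 1 ≤ s * (K ^ 3 * τ))
    (h' : (s * N ^ 2) ^ 2 ≤ K ^ 35 * N * (s * E)) : N ^ 3 ≤ K ^ 38 * τ * E := by
  have h2 : s * N ^ 3 ≤ K ^ 35 * E := by
    have : (s * N ^ 3) * (s * N) ≤ K ^ 35 * E * (s * N) := by
      calc _ = (s * N ^ 2) ^ 2 := by ring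
        _ ≤ _ := h'
        _ = _ := by ring
    exact le_of_mul_le_mul_right this (by positivity)
  calc N ^ 3 = 1 * N ^ 3 := by ring
    _ ≤ (s * (K ^ 3 * τ)) * N ^ 3 := by gcongr
    _ = (K ^ 3 * τ) * (s * N ^ 3) := by ring
    _ ≤ (K ^ 3 * τ) * (K ^ 35 * E) := by gcongr
    _ = _ := by ring

namespace IsAlmostRing

variable {ρ δ K : ℝ} {P : Finset ℝ}

lemma abs_sub_le_two_mul (h : IsAlmostRing ρ δ K P) {p q : ℝ} (hp : p ∈ P) (hq : q ∈ P) :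
    |p - q| ≤ 2 * K := by
  have := abs_sub p q
  linarith [h.abs_bound p hp, h.abs_bound q hq]

lemma abs_le_mul_of_mem (h : IsAlmostRing ρ δ K P) {b x : ℝ} (hb : b ∈ P) :
    |x| ≤ K * |b * x| := by
  rw [abs_mul, ← mul_assoc]
  exact le_mul_of_one_le_left (abs_nonneg x) (h.one_le b hb)

/-- A maximal `d`-separated subset is large, by non-concentration. -/
lemma exists_large_separated_subset (h : IsAlmostRing ρ δ K P) {Q : Finset ℝ} (hQ : Q ⊆ P)
    {d : ℝ} (hd : δ ≤ d) :
    ∃ S ⊆ Q, (∀ x ∈ S, ∀ y ∈ S, x ≠ y → d < |x - y|) ∧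
      (Q.card : ℝ) ≤ S.card * (K * P.card * √d) := by
  have hδ : 0 < δ := h.rho_pos.trans_le h.rho_le
  obtain ⟨S, hS, hsep, hcov⟩ := exists_separated_subset Q (hδ.le.trans hd)
  refine ⟨S, hS, hsep, card_le_card_mul_of_cover hcov fun x _ => ?_⟩
  refine le_trans ?_ (h.frost x d hd)
  exact_mod_cast Finset.card_le_card (Finset.filter_subset_filter _ hQ)

lemma card_cube_le_energy (h : IsAlmostRing ρ δ K P) {b : ℝ} (hb : b ∈ P) {Q : Finset ℝ}
    (hQ : ∀ a ∈ Q, ((dilate ρ P b - dilate ρ P a).card : ℝ) ≤ K ^ 6 * P.card)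
    {a₁ a₂ a₃ a₄ : ℝ} (h₁ : a₁ ∈ Q) (h₂ : a₂ ∈ Q) (h₃ : a₃ ∈ Q) (h₄ : a₄ ∈ Q)
    {y L : ℝ} (hy0 : 0 ≤ y) (hy1 : y ≤ 1) (hL : 1 ≤ L)
    (hy : |a₁ - a₂ - y * (a₃ - a₄)| ≤ L * ρ) (hLt : L * ρ ≤ |a₃ - a₄|) (hδ : δ ≤ |a₃ - a₄|) :
    (P.card : ℝ) ^ 3 ≤
      K ^ 38 * √|a₃ - a₄| * energy P y (8 * K * L * ρ / |a₃ - a₄|) := by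
  classical
  have hK := h.le_K
  have hK0 := h.K_pos
  have hN := h.card_pos
  have hρ := h.rho_pos
  set t := a₃ - a₄ with ht
  set u := a₁ - a₂ with hu
  have ht0 : 0 < |t| := (hρ.trans_le h.rho_le).trans_le hδ
  have hK4 : (1 : ℝ) ≤ K ^ 4 := one_le_pow₀ (by linarith)
  obtain ⟨S, hSP, hsep, hS⟩ := h.exists_large_separated_subset (Finset.Subset.refl P)
    (d := K ^ 4 * |t|) (by nlinarith)
  have hsqrt : √(K ^ 4 * |t|) = K ^ 2 * √|t| := by
    rw [Real.sqrt_mul (by positivity), show K ^ 4 = (K ^ 2) ^ 2 by ring,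
      Real.sqrt_sq (by positivity)]
  rw [hsqrt] at hS
  have hS1 : 1 ≤ S.card * (K ^ 3 * √|t|) := by
    have : (1 : ℝ) * P.card ≤ S.card * (K ^ 3 * √|t|) * P.card := by
      calc _ = (P.card : ℝ) := one_mul _
        _ ≤ _ := hS
        _ = _ := by ring
    exact le_of_mul_le_mul_right this hN
  have hS0 : (0 : ℝ) < S.card := by
    by_contra hc
    have : (S.card : ℝ) = 0 := le_antisymm (not_lt.1 hc) (Nat.cast_nonneg _)
    rw [this] at hS1; linarith
  set B := dilate ρ P b ∪ (dilate ρ P a₁ ∪ (dilate ρ P a₂ ∪ (dilate ρ P a₃ ∪ dilate ρ P a₄)))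
    with hB
  have hcard : ((3 • B - 2 • B).card : ℝ) ≤ (K ^ 7) ^ (3 + 2) * P.card :=
    h.card_nsmul_sub_nsmul hb hQ h₁ h₂ h₃ h₄ 3 2
  have mem : ∀ {a p : ℝ}, p ∈ P → ⌊a * p / ρ⌋ ∈ dilate ρ P a := fun hp =>
    Finset.mem_image_of_mem _ hp
  let Φ : ℝ × (ℝ × ℝ) → ℤ := fun s =>
    (⌊b * s.1 / ρ⌋ + ⌊a₃ * s.2.1 / ρ⌋ + ⌊a₂ * s.2.2 / ρ⌋) -
      (⌊a₄ * s.2.1 / ρ⌋ + ⌊a₁ * s.2.2 / ρ⌋)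
  have himg : (S ×ˢ (P ×ˢ P)).image Φ ⊆ 3 • B - 2 • B := by
    intro z hz
    obtain ⟨⟨p₀, p, q⟩, hs, rfl⟩ := Finset.mem_image.1 hz
    simp only [Finset.mem_product] at hs
    obtain ⟨hp₀, hp, hq⟩ := hs
    rw [show 3 • B = B + B + B by rw [succ_nsmul, two_nsmul], two_nsmul]
    refine Finset.sub_mem_sub (Finset.add_mem_add (Finset.add_mem_add ?_ ?_) ?_)
      (Finset.add_mem_add ?_ ?_) <;> simp only [hB, Finset.mem_union]
    · exact Or.inl (mem (hSP hp₀))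
    · exact Or.inr (Or.inr (Or.inr (Or.inl (mem hp))))
    · exact Or.inr (Or.inr (Or.inl (mem hq)))
    · exact Or.inr (Or.inr (Or.inr (Or.inr (mem hp))))
    · exact Or.inr (Or.inl (mem hq))
  have hcs := card_sq_le_card_image_mul (S ×ˢ (P ×ˢ P)) Φ
  have hut : |u| ≤ 2 * |t| := by
    have h1 : |u| ≤ |u - y * t| + |y * t| := by
      have := abs_add_le (u - y * t) (y * t); simpa using this
    have h2 : |y * t| ≤ |t| := by
      rw [abs_mul, abs_of_nonneg hy0]; nlinarith
    linarith
  -- a collision forces the first coordinates to agree and counts towards the energy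
  have key : ∀ p₀ ∈ S, ∀ p ∈ P, ∀ q ∈ P, ∀ p₀' ∈ S, ∀ p' ∈ P, ∀ q' ∈ P,
      Φ (p₀, p, q) = Φ (p₀', p', q') →
        p₀ = p₀' ∧ |p - p' - y * (q - q')| ≤ 8 * K * L * ρ / |t| := by
    intro p₀ hp₀ p hp q hq p₀' hp₀' p' hp' q' hq' heq
    have tot : |b * (p₀ - p₀') + (t * (p - p') - u * (q - q'))| ≤ 5 * ρ := by
      have := abs_sub_le_of_floor_eq hρ heq
      rwa [show (b * p₀ + a₃ * p + a₂ * q - (a₄ * p + a₁ * q)) -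
        (b * p₀' + a₃ * p' + a₂ * q' - (a₄ * p' + a₁ * q')) =
        b * (p₀ - p₀') + (t * (p - p') - u * (q - q')) by rw [ht, hu]; ring] at this
    have hpp := h.abs_sub_le_two_mul hp hp'
    have hqq := h.abs_sub_le_two_mul hq hq'
    have hp0 : p₀ = p₀' := by
      by_contra hne
      have s1 := hsep p₀ hp₀ p₀' hp₀' hne
      have s2 := h.abs_le_mul_of_mem (x := p₀ - p₀') hb
      have s3 : |b * (p₀ - p₀')| ≤ 5 * ρ + (|t| * (2 * K) + 2 * |t| * (2 * K)) := by
        have r1 : |t * (p - p')| ≤ |t| * (2 * K) := by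
          rw [abs_mul]; gcongr
        have r2 : |u * (q - q')| ≤ 2 * |t| * (2 * K) := by
          rw [abs_mul]; gcongr
        rw [abs_le] at tot r1 r2 ⊢
        constructor <;> linarith
      have s4 : K * |b * (p₀ - p₀')| ≤ K * (11 * K * |t|) := by
        gcongr
        nlinarith [h.rho_le]
      have s5 : K * (11 * K * |t|) ≤ K ^ 4 * |t| := by
        have h11 : 11 ≤ K ^ 2 := by nlinarith
        calc K * (11 * K * |t|) = 11 * (K ^ 2 * |t|) := by ring
          _ ≤ K ^ 2 * (K ^ 2 * |t|) := by gcongr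
          _ = K ^ 4 * |t| := by ring
      linarith
    refine ⟨hp0, ?_⟩
    rw [hp0, sub_self, mul_zero, zero_add] at tot
    rw [le_div_iff₀ ht0, ← abs_mul]
    have r3 : |(u - y * t) * (q - q')| ≤ L * ρ * (2 * K) := by
      rw [abs_mul]; gcongr
    have r4 : 5 * ρ ≤ 5 * (K * L * ρ) := by
      have hKL : 1 ≤ K * L := one_le_mul_of_one_le_of_one_le (by linarith) hL
      have := mul_le_mul_of_nonneg_right hKL hρ.le
      linarith
    have r5 : (p - p' - y * (q - q')) * t
        = (t * (p - p') - u * (q - q')) + (u - y * t) * (q - q') := by ring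
    rw [r5]
    have := abs_add_le (t * (p - p') - u * (q - q')) ((u - y * t) * (q - q'))
    have r6 := mul_pos (mul_pos hK0 (by linarith : 0 < L)) hρ
    linarith
  have hpairs : ((((S ×ˢ (P ×ˢ P)) ×ˢ (S ×ˢ (P ×ˢ P))).filter
      fun z => Φ z.1 = Φ z.2).card : ℝ) ≤ S.card * energy P y (8 * K * L * ρ / |t|) := by
    rw [energy, ← Nat.cast_mul, ← Finset.card_product, Nat.cast_le]
    apply Finset.card_le_card_of_injOn (fun z => (z.1.1, (z.1.2, z.2.2)))
    · rintro ⟨⟨p₀, p, q⟩, p₀', p', q'⟩ hz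
      simp only [Finset.coe_filter, Finset.mem_product, Set.mem_ofPred_eq] at hz
      obtain ⟨⟨⟨a1, a2, a3⟩, a4, a5, a6⟩, a7⟩ := hz
      simp only [Finset.coe_product, Finset.coe_filter, Set.mem_prod, Finset.mem_coe,
        Finset.mem_product, Set.mem_ofPred_eq]
      exact ⟨a1, ⟨⟨a2, a3⟩, a5, a6⟩, (key _ a1 _ a2 _ a3 _ a4 _ a5 _ a6 a7).2⟩
    · rintro ⟨⟨p₀, p, q⟩, p₀', p', q'⟩ hz ⟨⟨r₀, r, s⟩, r₀', r', s'⟩ hz' heq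
      simp only [Finset.coe_filter, Finset.mem_product, Set.mem_ofPred_eq] at hz hz'
      obtain ⟨⟨⟨a1, a2, a3⟩, a4, a5, a6⟩, a7⟩ := hz
      obtain ⟨⟨⟨b1, b2, b3⟩, b4, b5, b6⟩, b7⟩ := hz'
      have k1 := (key _ a1 _ a2 _ a3 _ a4 _ a5 _ a6 a7).1
      have k2 := (key _ b1 _ b2 _ b3 _ b4 _ b5 _ b6 b7).1
      simp only [Prod.mk.injEq] at heq ⊢
      obtain ⟨c1, ⟨c2, c3⟩, c4, c5⟩ := heq
      exact ⟨⟨c1, c2, c3⟩, by rw [← k1, ← k2, c1], c4, c5⟩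
  obtain ⟨E, hE⟩ : ∃ E : ℝ, E = ((energy P y (8 * K * L * ρ / |t|) : ℕ) : ℝ) := ⟨_, rfl⟩
  have hE0 : 0 ≤ E := hE ▸ Nat.cast_nonneg _
  rw [← hE] at hpairs ⊢
  have himg' : (((S ×ˢ (P ×ˢ P)).image Φ).card : ℝ) ≤ K ^ 35 * P.card := by
    refine le_trans (Nat.cast_le.2 (Finset.card_le_card himg)) (hcard.trans (le_of_eq ?_))
    rw [← pow_mul]
  have h1 : ((S.card : ℝ) * P.card ^ 2) ^ 2 ≤ K ^ 35 * P.card * (S.card * E) := by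
    have : (((S ×ˢ (P ×ˢ P)).card : ℕ) : ℝ) = S.card * P.card ^ 2 := by
      rw [Finset.card_product, Finset.card_product]; push_cast; ring
    rw [this] at hcs
    exact hcs.trans (mul_le_mul himg' hpairs (by positivity) (by positivity))
  exact cube_le_of_cauchy_schwarz hS0 hN hK0 (Real.sqrt_nonneg _) hS1 h1

end IsAlmostRing

lemma card_le_of_separated {α : Type*} (s : Finset α) (f : α → ℝ) {d w x : ℝ} (hd : 0 < d)
    (hw : 0 ≤ w) (hsep : ∀ a ∈ s, ∀ b ∈ s, a ≠ b → d ≤ |f a - f b|)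
    (hx : ∀ a ∈ s, |f a - x| ≤ w) : (s.card : ℝ) ≤ 2 * w / d + 1 := by
  have h1 : s.card ≤ (Finset.range (⌊2 * w / d⌋₊ + 1)).card := by
    apply Finset.card_le_card_of_injOn (fun a => ⌊(f a - (x - w)) / d⌋₊)
    · intro a ha
      have := abs_le.1 (hx a ha)
      simp only [Finset.coe_range, Set.mem_Iio, Nat.lt_succ_iff]
      apply Nat.floor_le_floor
      gcongr
      linarith
    · intro a ha b hb hab
      by_contra hne
      have h0 : ∀ c ∈ s, 0 ≤ (f c - (x - w)) / d := fun c hc => by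
        have := abs_le.1 (hx c hc)
        exact div_nonneg (by linarith) hd.le
      have e1 := Nat.floor_le (h0 a ha)
      have e2 := Nat.lt_floor_add_one ((f a - (x - w)) / d)
      have e3 := Nat.floor_le (h0 b hb)
      have e4 := Nat.lt_floor_add_one ((f b - (x - w)) / d)
      simp only at hab
      rw [hab] at e1 e2
      have h2 := hsep a ha b hb hne
      have h3 : |(f a - (x - w)) / d - (f b - (x - w)) / d| < 1 := by
        rw [abs_lt]; constructor <;> linarith
      rw [← sub_div, abs_div, abs_of_pos hd, div_lt_one hd] at h3
      rw [show f a - (x - w) - (f b - (x - w)) = f a - f b by ring] at h3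
      linarith
  rw [Finset.card_range] at h1
  calc (s.card : ℝ) ≤ ((⌊2 * w / d⌋₊ + 1 : ℕ) : ℝ) := by exact_mod_cast h1
    _ ≤ _ := by
      push_cast
      linarith [Nat.floor_le (show 0 ≤ 2 * w / d by positivity)]

lemma exists_dyadic {T x : ℝ} {n : ℕ} (hT : T ≤ x) (hx : x < 2 ^ n * T) :
    ∃ j ∈ Finset.range n, 2 ^ j * T ≤ x ∧ x < 2 ^ (j + 1) * T := by
  induction n with
  | zero => simp at hx; linarith
  | succ n ih =>
    by_cases h : x < 2 ^ n * T
    · obtain ⟨j, hj, h1⟩ := ih h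
      exact ⟨j, Finset.mem_range.2 ((Finset.mem_range.1 hj).trans n.lt_succ_self), h1⟩
    · exact ⟨n, by simp, not_lt.1 h, hx⟩

lemma sqrt_two_pow_succ_mul (j : ℕ) {T : ℝ} :
    √(2 ^ (j + 1) * T) = √2 * √(2 ^ j * T) := by
  rw [← Real.sqrt_mul (by norm_num)]
  congr 1; ring

namespace IsAlmostRing

variable {ρ δ K : ℝ} {P : Finset ℝ}

lemma delta_pos (h : IsAlmostRing ρ δ K P) : 0 < δ := h.rho_pos.trans_le h.rho_le

lemma sum_inv_sqrt_le (h : IsAlmostRing ρ δ K P) {V : ℝ} (hV : δ ≤ V) {n : ℕ}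
    (hn : 2 * K < 2 ^ n * V) {q : ℝ} (hq : q ∈ P) :
    ∑ q' ∈ P.filter (fun q' => V < |q' - q|), 1 / √|q' - q| ≤ n * (2 * K * P.card) := by
  have hV0 : 0 < V := h.delta_pos.trans_le hV
  have hK := h.K_pos
  have step : ∀ q' ∈ P.filter (fun q' => V < |q' - q|), 1 / √|q' - q| ≤
      ∑ j ∈ Finset.range n, if |q' - q| ≤ 2 ^ (j + 1) * V then 1 / √(2 ^ j * V) else 0 := by
    intro q' hq'
    obtain ⟨h1, h2⟩ := Finset.mem_filter.1 hq'
    obtain ⟨j, hj, h3, h4⟩ := exists_dyadic h2.le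
      ((h.abs_sub_le_two_mul h1 hq).trans_lt hn)
    refine le_trans ?_ (Finset.single_le_sum (fun i _ => ?_) hj)
    · rw [if_pos h4.le]
      apply one_div_le_one_div_of_le
      · exact Real.sqrt_pos.2 (by positivity)
      · exact Real.sqrt_le_sqrt h3
    · split_ifs <;> positivity
  calc _ ≤ ∑ q' ∈ P.filter (fun q' => V < |q' - q|), ∑ j ∈ Finset.range n,
        (if |q' - q| ≤ 2 ^ (j + 1) * V then 1 / √(2 ^ j * V) else 0) := Finset.sum_le_sum step
    _ ≤ ∑ q' ∈ P, ∑ j ∈ Finset.range n,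
        (if |q' - q| ≤ 2 ^ (j + 1) * V then 1 / √(2 ^ j * V) else 0) := by
      apply Finset.sum_le_sum_of_subset_of_nonneg (Finset.filter_subset _ _)
      intro i _ _
      exact Finset.sum_nonneg fun j _ => by split_ifs <;> positivity
    _ = ∑ j ∈ Finset.range n, ∑ q' ∈ P,
        (if |q' - q| ≤ 2 ^ (j + 1) * V then 1 / √(2 ^ j * V) else 0) := Finset.sum_comm
    _ ≤ ∑ j ∈ Finset.range n, (2 * K * P.card) := by
      apply Finset.sum_le_sum
      intro j _
      rw [← Finset.sum_filter, Finset.sum_const, nsmul_eq_mul]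
      have hj : 1 ≤ (2 : ℝ) ^ (j + 1) := one_le_pow₀ (by norm_num)
      have h1 := h.frost q (2 ^ (j + 1) * V) (by nlinarith)
      rw [sqrt_two_pow_succ_mul] at h1
      have hs : 0 < √(2 ^ j * V) := Real.sqrt_pos.2 (by positivity)
      have h2 : √2 ≤ 2 := by
        rw [Real.sqrt_le_left (by norm_num)]; norm_num
      rw [mul_one_div, div_le_iff₀ hs]
      calc _ ≤ _ := h1
        _ ≤ K * P.card * (2 * √(2 ^ j * V)) := by gcongr
        _ = _ := by ring
    _ = _ := by simp

end IsAlmostRing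

lemma energy_eq_sum (P : Finset ℝ) (y w : ℝ) :
    (energy P y w : ℝ) = ∑ q ∈ P, ∑ q' ∈ P, ∑ p ∈ P, ∑ p' ∈ P,
      if |p' - p - y * (q' - q)| ≤ w then (1 : ℝ) else 0 := by
  have h1 : (energy P y w : ℝ) = ∑ p' ∈ P, ∑ q' ∈ P, ∑ p ∈ P, ∑ q ∈ P,
      if |p' - p - y * (q' - q)| ≤ w then (1 : ℝ) else 0 := by
    rw [energy, Finset.card_filter]
    push_cast
    simp only [Finset.sum_product]
  rw [h1]
  calc _ = ∑ p' ∈ P, ∑ q' ∈ P, ∑ q ∈ P, ∑ p ∈ P,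
        (if |p' - p - y * (q' - q)| ≤ w then (1 : ℝ) else 0) :=
        Finset.sum_congr rfl fun _ _ => Finset.sum_congr rfl fun _ _ => Finset.sum_comm
    _ = ∑ p' ∈ P, ∑ q ∈ P, ∑ q' ∈ P, ∑ p ∈ P,
        (if |p' - p - y * (q' - q)| ≤ w then (1 : ℝ) else 0) :=
        Finset.sum_congr rfl fun _ _ => Finset.sum_comm
    _ = ∑ q ∈ P, ∑ p' ∈ P, ∑ q' ∈ P, ∑ p ∈ P,
        (if |p' - p - y * (q' - q)| ≤ w then (1 : ℝ) else 0) := Finset.sum_comm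
    _ = ∑ q ∈ P, ∑ q' ∈ P, ∑ p' ∈ P, ∑ p ∈ P,
        (if |p' - p - y * (q' - q)| ≤ w then (1 : ℝ) else 0) :=
        Finset.sum_congr rfl fun _ _ => Finset.sum_comm
    _ = _ := Finset.sum_congr rfl fun _ _ => Finset.sum_congr rfl fun _ _ => Finset.sum_comm

lemma energy_mono (P : Finset ℝ) (y : ℝ) {w w' : ℝ} (h : w ≤ w') :
    energy P y w ≤ energy P y w' :=
  Finset.card_le_card (Finset.monotone_filter_right _ fun _ _ hz => hz.trans h)

namespace IsAlmostRing

variable {ρ δ K : ℝ} {P : Finset ℝ}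

lemma card_near_le (h : IsAlmostRing ρ δ K P) {w : ℝ} (hw : 0 ≤ w) (x : ℝ) :
    ((P.filter fun p => |p - x| ≤ w).card : ℝ) ≤ w / ρ + 1 := by
  have hρ := h.rho_pos
  refine (card_le_of_separated _ id (mul_pos two_pos hρ) hw (x := x) ?_ ?_).trans_eq ?_
  · intro a ha b hb hne
    exact h.sep a (Finset.mem_filter.1 ha).1 b (Finset.mem_filter.1 hb).1 hne
  · intro a ha
    exact (Finset.mem_filter.1 ha).2
  · rw [mul_div_mul_left _ _ two_ne_zero]

lemma sum_near_le (h : IsAlmostRing ρ δ K P) {w : ℝ} (hw : 0 ≤ w) (H : ℕ) (p d : ℝ) :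
    ∑ k ∈ Finset.range H, ∑ p' ∈ P,
      (if |p' - p - (k / H : ℝ) * d| ≤ w then (1 : ℝ) else 0) ≤ H * (w / ρ + 1) := by
  calc _ ≤ ∑ k ∈ Finset.range H, (w / ρ + 1) := by
        apply Finset.sum_le_sum
        intro k _
        rw [← Finset.sum_filter, Finset.sum_const, nsmul_eq_mul, mul_one]
        simp only [sub_sub]
        exact h.card_near_le hw _
    _ = _ := by rw [Finset.sum_const, Finset.card_range, nsmul_eq_mul]

lemma sum_far_le (h : IsAlmostRing ρ δ K P) {w V : ℝ} (hw : 0 < w) (hwV : w ≤ V) (hV : δ ≤ V)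
    {H : ℕ} (hH : 2 * K ≤ w * H) (p : ℝ) {d : ℝ} (hd : V < |d|) (hd' : |d| ≤ 2 * K) :
    ∑ k ∈ Finset.range H, ∑ p' ∈ P,
      (if |p' - p - (k / H : ℝ) * d| ≤ w then (1 : ℝ) else 0) ≤
        (6 * K * P.card * w * H) * (1 / √|d|) := by
  have hd0 : 0 < |d| := hw.trans_le (hwV.trans hd.le)
  have hK := h.K_pos
  have hN := h.card_pos
  have hH0 : (0 : ℝ) < H := by
    by_contra hc
    have : (H : ℝ) = 0 := le_antisymm (not_lt.1 hc) (Nat.cast_nonneg _)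
    rw [this] at hH; linarith
  rw [Finset.sum_comm]
  have step : ∀ p' ∈ P, ∑ k ∈ Finset.range H,
      (if |p' - p - (k / H : ℝ) * d| ≤ w then (1 : ℝ) else 0) ≤
      if |p' - p| ≤ 2 * |d| then 3 * w * H / |d| else 0 := by
    intro p' _
    split_ifs with hp'
    · rw [← Finset.sum_filter, Finset.sum_const, nsmul_eq_mul, mul_one]
      refine (card_le_of_separated _ (fun k : ℕ => (k / H : ℝ) * d) (d := |d| / H)
        (by positivity) hw.le (x := p' - p) ?_ ?_).trans ?_
      · intro a _ b _ hne
        rw [← sub_mul, abs_mul, ← sub_div, abs_div, abs_of_pos hH0]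
        have : (1 : ℝ) ≤ |(a : ℝ) - b| := by
          have h1 : (a : ℤ) - b ≠ 0 := sub_ne_zero.2 (by exact_mod_cast hne)
          exact_mod_cast Int.one_le_abs h1
        calc |d| / H = 1 / H * |d| := by ring
          _ ≤ _ := by gcongr
      · intro a ha
        rw [abs_sub_comm]
        exact (Finset.mem_filter.1 ha).2
      · have h1 : 1 ≤ w * H / |d| := by
          rw [le_div_iff₀ hd0]; linarith
        have h2 : 2 * w / (|d| / H) = 2 * (w * H / |d|) := by field_simp
        have h3 : 3 * w * H / |d| = 3 * (w * H / |d|) := by ring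
        rw [h2, h3]; linarith
    · apply le_of_eq
      apply Finset.sum_eq_zero
      intro k hk
      rw [if_neg]
      intro hc
      apply hp'
      have hk1 : (k / H : ℝ) ≤ 1 := by
        rw [div_le_one hH0]
        exact_mod_cast (Finset.mem_range.1 hk).le
      have hk0 : (0 : ℝ) ≤ k / H := by positivity
      have h1 : |(k / H : ℝ) * d| ≤ |d| := by
        rw [abs_mul, abs_of_nonneg hk0]
        exact mul_le_of_le_one_left hd0.le hk1
      have h2 := abs_add_le (p' - p - (k / H : ℝ) * d) ((k / H : ℝ) * d)
      rw [sub_add_cancel] at h2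
      linarith
  have hsd : 0 < √|d| := Real.sqrt_pos.2 hd0
  calc _ ≤ ∑ p' ∈ P, (if |p' - p| ≤ 2 * |d| then 3 * w * H / |d| else 0) :=
        Finset.sum_le_sum step
    _ = ((P.filter fun p' => |p' - p| ≤ 2 * |d|).card : ℝ) * (3 * w * H / |d|) := by
        rw [← Finset.sum_filter, Finset.sum_const, nsmul_eq_mul]
    _ ≤ (K * P.card * √(2 * |d|)) * (3 * w * H / |d|) := by
        gcongr
        exact h.frost p _ (by linarith)
    _ ≤ (K * P.card * (2 * √|d|)) * (3 * w * H / |d|) := by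
        gcongr
        rw [Real.sqrt_mul (by norm_num)]
        gcongr
        rw [Real.sqrt_le_left (by norm_num)]; norm_num
    _ = _ := by
        nth_rewrite 2 [← Real.mul_self_sqrt hd0.le]
        field_simp
        ring

lemma sum_energy_le (h : IsAlmostRing ρ δ K P) {w V : ℝ} (hw : 0 < w) (hwV : w ≤ V)
    (hV : δ ≤ V) {H : ℕ} (hH : 2 * K ≤ w * H) {n : ℕ} (hn : 2 * K < 2 ^ n * V) :
    ∑ k ∈ Finset.range H, (energy P (k / H : ℝ) w : ℝ) ≤
      H * (P.card ^ 3 * (K * √V * (w / ρ + 1)) + n * (12 * K ^ 2) * P.card ^ 4 * w) := by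
  have hK := h.K_pos
  have hN := h.card_pos
  have hρ := h.rho_pos
  set N := (P.card : ℝ) with hNdef
  set R : ℝ := H * (w / ρ + 1) with hR
  have hR0 : 0 ≤ R := by positivity
  simp only [energy_eq_sum]
  have hcomm : ∑ k ∈ Finset.range H, ∑ q ∈ P, ∑ q' ∈ P, ∑ p ∈ P, ∑ p' ∈ P,
      (if |p' - p - (k / H : ℝ) * (q' - q)| ≤ w then (1 : ℝ) else 0) =
      ∑ q ∈ P, ∑ q' ∈ P, ∑ p ∈ P, ∑ k ∈ Finset.range H, ∑ p' ∈ P,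
      (if |p' - p - (k / H : ℝ) * (q' - q)| ≤ w then (1 : ℝ) else 0) := by
    rw [Finset.sum_comm]
    refine Finset.sum_congr rfl fun q _ => ?_
    rw [Finset.sum_comm]
    exact Finset.sum_congr rfl fun q' _ => Finset.sum_comm
  rw [hcomm]
  have inner : ∀ q ∈ P, ∑ q' ∈ P, ∑ p ∈ P, ∑ k ∈ Finset.range H, ∑ p' ∈ P,
      (if |p' - p - (k / H : ℝ) * (q' - q)| ≤ w then (1 : ℝ) else 0) ≤
      N * (K * N * √V * R + (6 * K * N * w * H) * (n * (2 * K * N))) := by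
    intro q hq
    rw [← Finset.sum_filter_add_sum_filter_not P (fun q' => |q' - q| ≤ V), mul_add]
    apply add_le_add
    · calc _ ≤ ∑ q' ∈ P.filter (fun q' => |q' - q| ≤ V), ∑ p ∈ P, R :=
            Finset.sum_le_sum fun q' _ => Finset.sum_le_sum fun p _ => h.sum_near_le hw.le H p _
        _ = N * (((P.filter fun q' => |q' - q| ≤ V).card : ℝ) * R) := by
            simp only [Finset.sum_const, nsmul_eq_mul]; ring
        _ ≤ N * ((K * N * √V) * R) := by
            gcongr
            exact h.frost q V hV
    · simp only [not_le]
      calc _ ≤ ∑ q' ∈ P.filter (fun q' => V < |q' - q|), ∑ p ∈ P,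
              (6 * K * N * w * H) * (1 / √|q' - q|) := by
            refine Finset.sum_le_sum fun q' hq' => Finset.sum_le_sum fun p _ => ?_
            obtain ⟨h1, h2⟩ := Finset.mem_filter.1 hq'
            exact h.sum_far_le hw hwV hV hH p h2 (h.abs_sub_le_two_mul h1 hq)
        _ = N * ((6 * K * N * w * H) *
              ∑ q' ∈ P.filter (fun q' => V < |q' - q|), 1 / √|q' - q|) := by
            simp only [Finset.sum_const, nsmul_eq_mul]
            rw [Finset.mul_sum, Finset.mul_sum]
        _ ≤ _ := by
            gcongr
            exact h.sum_inv_sqrt_le hV hn hq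
  calc _ ≤ ∑ q ∈ P, N * (K * N * √V * R + (6 * K * N * w * H) * (n * (2 * K * N))) :=
        Finset.sum_le_sum inner
    _ = _ := by
        rw [Finset.sum_const, nsmul_eq_mul, ← hNdef, hR]
        ring

end IsAlmostRing

lemma layer_bound {K L N ρ σ s v w τ n h : ℝ} (hK : 100 ≤ K) (hL : 1 ≤ L) (hN : 0 < N)
    (hρ : 0 < ρ) (hs : 0 < s) (hsσ : s ≤ σ) (hτ : σ ^ 2 = τ) (hτK : τ ≤ 2 * K) (hv : 0 ≤ v)
    (hw : w = 8 * K * L * ρ / τ) (hn : n ≤ K) (hh : 0 ≤ h)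
    (h1 : L * v * K ^ 45 ≤ s) (h2 : N * ρ * L * K ^ 45 ≤ s) :
    2 * K ^ 38 * σ * (h * (N ^ 3 * (K * v * (w / ρ + 1)) + n * (12 * K ^ 2) * N ^ 4 * w)) ≤
      h * N ^ 3 * (1 / (2 * K)) := by
  have hK0 : 0 < K := by linarith
  have hσ : 0 < σ := hs.trans_le hsσ
  have hL0 : 0 < L := by linarith
  have hτ0 : 0 < τ := hτ ▸ by positivity
  have e1 : σ * (w / ρ + 1) ≤ 10 * K * L / s := by
    have : σ * (w / ρ + 1) ≤ 10 * K * L / σ := by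
      rw [le_div_iff₀ hσ, hw]
      have : σ * (8 * K * L * ρ / τ / ρ + 1) * σ = 8 * K * L + τ := by
        rw [← hτ]; field_simp
      rw [this]
      nlinarith
    exact this.trans (by gcongr)
  have e2 : σ * w ≤ 8 * K * L * ρ / s := by
    have : σ * w = 8 * K * L * ρ / σ := by
      rw [hw, ← hτ]; field_simp
    rw [this]; gcongr
  have f1 : L * v / s ≤ 1 / K ^ 45 := by
    rw [div_le_div_iff₀ hs (by positivity)]; linarith
  have f2 : N * ρ * L / s ≤ 1 / K ^ 45 := by
    rw [div_le_div_iff₀ hs (by positivity)]; linarith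
  have hw0 : 0 ≤ w := by rw [hw]; positivity
  calc _ ≤ 2 * K ^ 38 * σ *
        (h * (N ^ 3 * (K * v * (w / ρ + 1)) + K * (12 * K ^ 2) * N ^ 4 * w)) := by
        gcongr
    _ = 2 * K ^ 38 * h * N ^ 3 * (K * v * (σ * (w / ρ + 1)) + 12 * K ^ 3 * N * (σ * w)) := by ring
    _ ≤ 2 * K ^ 38 * h * N ^ 3 *
        (K * v * (10 * K * L / s) + 12 * K ^ 3 * N * (8 * K * L * ρ / s)) := by
        gcongr
    _ = 2 * K ^ 38 * h * N ^ 3 *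
        (10 * K ^ 2 * (L * v / s) + 96 * K ^ 4 * (N * ρ * L / s)) := by ring
    _ ≤ 2 * K ^ 38 * h * N ^ 3 * (10 * K ^ 2 * (1 / K ^ 45) + 96 * K ^ 4 * (1 / K ^ 45)) := by
        gcongr
    _ = h * N ^ 3 * ((20 * K ^ 40 + 192 * K ^ 42) / K ^ 45) := by ring
    _ ≤ h * N ^ 3 * (1 / (2 * K)) := by
        refine mul_le_mul_of_nonneg_left ?_ (by positivity)
        rw [div_le_div_iff₀ (by positivity) (by positivity)]
        have g1 : K ^ 41 ≤ K ^ 43 := pow_le_pow_right₀ (by linarith) (by norm_num)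
        have g2 : 10000 * K ^ 43 ≤ K ^ 45 := by
          have : (10000 : ℝ) ≤ K ^ 2 := by nlinarith
          calc 10000 * K ^ 43 ≤ K ^ 2 * K ^ 43 := by gcongr
            _ = _ := by ring
        have g3 : 0 < K ^ 43 := by positivity
        calc (20 * K ^ 40 + 192 * K ^ 42) * (2 * K) = 40 * K ^ 41 + 384 * K ^ 43 := by ring
          _ ≤ 1 * K ^ 45 := by linarith

namespace IsAlmostRing

variable {ρ δ K : ℝ} {P : Finset ℝ}

/-- If every `y ∈ [0, 1]` is approximated by a quotient of differences of elements of `Q`, then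
averaging the lower bounds for the energies over `y` is contradictory. -/
lemma false_of_quotients_dense (h : IsAlmostRing ρ δ K P) {b : ℝ} (hb : b ∈ P) {Q : Finset ℝ}
    (hQP : Q ⊆ P)
    (hQ : ∀ a ∈ Q, ((dilate ρ P b - dilate ρ P a).card : ℝ) ≤ K ^ 6 * P.card)
    {T L V : ℝ} (hV : δ ≤ V) (hT : δ ≤ T) (hL : 1 ≤ L) (hLT : L * ρ ≤ T)
    (hwV : 8 * K * L * ρ / T ≤ V) {n : ℕ} (hnT : 2 * K < 2 ^ n * T) (hnV : 2 * K < 2 ^ n * V)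
    (hnK : (n : ℝ) ≤ K)
    (hy : ∀ y : ℝ, 0 ≤ y → y ≤ 1 → ∃ a₁ ∈ Q, ∃ a₂ ∈ Q, ∃ a₃ ∈ Q, ∃ a₄ ∈ Q,
      T ≤ |a₃ - a₄| ∧ |a₁ - a₂ - y * (a₃ - a₄)| ≤ L * ρ)
    (h1 : L * √V * K ^ 45 ≤ √T) (h2 : P.card * ρ * L * K ^ 45 ≤ √T) : False := by
  classical
  have hK := h.le_K
  have hK0 := h.K_pos
  have hN := h.card_pos
  have hρ := h.rho_pos
  have hT0 : 0 < T := h.delta_pos.trans_le hT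
  have hL0 : 0 < L := by linarith
  set H : ℕ := ⌈2 ^ n * T / ρ⌉₊ with hH
  have hH1 : 2 ^ n * T ≤ ρ * H := by
    have := Nat.le_ceil (2 ^ n * T / ρ)
    rwa [div_le_iff₀ hρ, mul_comm _ ρ] at this
  have hH0 : (0 : ℝ) < H := by
    by_contra hc
    have : (H : ℝ) = 0 := le_antisymm (not_lt.1 hc) (Nat.cast_nonneg _)
    rw [this, mul_zero] at hH1
    have : 0 < 2 ^ n * T := by positivity
    linarith
  set J := (Finset.range n).filter fun j => 2 ^ j * T ≤ 2 * K with hJ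
  set w : ℕ → ℝ := fun j => 8 * K * L * ρ / (2 ^ j * T) with hw
  have lower : ∀ k ∈ Finset.range H, (P.card : ℝ) ^ 3 ≤
      ∑ j ∈ J, 2 * K ^ 38 * √(2 ^ j * T) * energy P (k / H : ℝ) (w j) := by
    intro k hk
    have hk1 : (k / H : ℝ) ≤ 1 := by
      rw [div_le_one hH0]
      exact_mod_cast (Finset.mem_range.1 hk).le
    have hk0 : (0 : ℝ) ≤ k / H := by positivity
    obtain ⟨a₁, m₁, a₂, m₂, a₃, m₃, a₄, m₄, ht, hyk⟩ := hy _ hk0 hk1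
    have ht2 := h.abs_sub_le_two_mul (hQP m₃) (hQP m₄)
    obtain ⟨j, hj, hj1, hj2⟩ := exists_dyadic ht (ht2.trans_lt hnT)
    have hE := h.card_cube_le_energy hb hQ m₁ m₂ m₃ m₄ hk0 hk1 hL hyk (hLT.trans ht)
      (hT.trans ht)
    have hjJ : j ∈ J := Finset.mem_filter.2 ⟨hj, hj1.trans ht2⟩
    refine le_trans ?_ (Finset.single_le_sum
      (f := fun j => 2 * K ^ 38 * √(2 ^ j * T) * (energy P (k / H : ℝ) (w j) : ℝ))
      (fun i _ => by positivity) hjJ)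
    refine hE.trans ?_
    have s1 : √|a₃ - a₄| ≤ 2 * √(2 ^ j * T) := by
      refine (Real.sqrt_le_sqrt hj2.le).trans ?_
      rw [sqrt_two_pow_succ_mul]
      gcongr
      rw [Real.sqrt_le_left (by norm_num)]; norm_num
    have s2 : (energy P (k / H : ℝ) (8 * K * L * ρ / |a₃ - a₄|) : ℝ) ≤
        energy P (k / H : ℝ) (w j) := by
      refine Nat.cast_le.2 (energy_mono _ _ ?_)
      simp only [hw]
      gcongr
    calc _ ≤ K ^ 38 * (2 * √(2 ^ j * T)) * energy P (k / H : ℝ) (w j) := by gcongr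
      _ = _ := by ring
  have total : (H : ℝ) * (P.card : ℝ) ^ 3 ≤
      ∑ j ∈ J, 2 * K ^ 38 * √(2 ^ j * T) *
        ∑ k ∈ Finset.range H, (energy P (k / H : ℝ) (w j) : ℝ) := by
    have := Finset.sum_le_sum lower
    rw [Finset.sum_const, Finset.card_range, nsmul_eq_mul, Finset.sum_comm] at this
    simpa only [Finset.mul_sum] using this
  have layer : ∀ j ∈ J, 2 * K ^ 38 * √(2 ^ j * T) *
        ∑ k ∈ Finset.range H, (energy P (k / H : ℝ) (w j) : ℝ) ≤
        H * (P.card : ℝ) ^ 3 * (1 / (2 * K)) := by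
    intro j hj
    obtain ⟨hjn, hjK⟩ := Finset.mem_filter.1 hj
    have hjn := Finset.mem_range.1 hjn
    have hτ : 0 < 2 ^ j * T := by positivity
    have hTτ : T ≤ 2 ^ j * T := le_mul_of_one_le_left hT0.le (one_le_pow₀ (by norm_num))
    have hw0 : 0 < w j := by simp only [hw]; positivity
    have hwV' : w j ≤ V := by
      refine le_trans ?_ hwV
      simp only [hw]; gcongr
    have hwH : 2 * K ≤ w j * H := by
      simp only [hw]
      rw [div_mul_eq_mul_div, le_div_iff₀ hτ]
      have g1 : 2 ^ j * T ≤ 2 ^ n * T := by gcongr; norm_num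
      have g2 : 2 * K * (2 ^ j * T) ≤ 2 * K * (ρ * H) :=
        mul_le_mul_of_nonneg_left (g1.trans hH1) (by positivity)
      have g3 : 2 * K * (ρ * H) * 1 ≤ 2 * K * (ρ * H) * (4 * L) := by
        gcongr; linarith
      linarith
    have hsum := h.sum_energy_le hw0 hwV' hV hwH hnV
    calc _ ≤ 2 * K ^ 38 * √(2 ^ j * T) * (H * (P.card ^ 3 * (K * √V * (w j / ρ + 1)) +
          n * (12 * K ^ 2) * P.card ^ 4 * w j)) := by gcongr
      _ ≤ _ := layer_bound hK hL hN hρ (Real.sqrt_pos.2 hT0) (Real.sqrt_le_sqrt hTτ)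
          (Real.sq_sqrt hτ.le) hjK (Real.sqrt_nonneg _) rfl hnK hH0.le h1 h2
  have hJn : (J.card : ℝ) ≤ K := by
    refine le_trans ?_ hnK
    exact_mod_cast (Finset.card_filter_le _ _).trans (Finset.card_range n).le
  have h3 := total.trans (Finset.sum_le_sum layer)
  rw [Finset.sum_const, nsmul_eq_mul] at h3
  have hpos : 0 < (H : ℝ) * (P.card : ℝ) ^ 3 := by positivity
  have h4 : (J.card : ℝ) * (1 / (2 * K)) ≤ 1 / 2 := by
    calc _ ≤ K * (1 / (2 * K)) := by gcongr
      _ = 1 / 2 := by field_simp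
  have h5 : (J.card : ℝ) * (H * (P.card : ℝ) ^ 3 * (1 / (2 * K))) ≤
      H * (P.card : ℝ) ^ 3 * (1 / 2) := by
    calc _ = H * (P.card : ℝ) ^ 3 * (J.card * (1 / (2 * K))) := by ring
      _ ≤ _ := by gcongr
  linarith

end IsAlmostRing

lemma abs_sub_le_of_floor_eq' {ρ x₁ x₂ x₃ x₄ x₅ x₆ x₇ y₁ y₂ y₃ y₄ y₅ y₆ y₇ : ℝ} (hρ : 0 < ρ)
    (h : ⌊x₁ / ρ⌋ + (⌊x₂ / ρ⌋ + ⌊x₂ / ρ⌋) + ⌊x₃ / ρ⌋ + ⌊x₄ / ρ⌋ -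
        (⌊x₅ / ρ⌋ + ⌊x₅ / ρ⌋ + ⌊x₆ / ρ⌋ + ⌊x₇ / ρ⌋) =
      ⌊y₁ / ρ⌋ + (⌊y₂ / ρ⌋ + ⌊y₂ / ρ⌋) + ⌊y₃ / ρ⌋ + ⌊y₄ / ρ⌋ -
        (⌊y₅ / ρ⌋ + ⌊y₅ / ρ⌋ + ⌊y₆ / ρ⌋ + ⌊y₇ / ρ⌋)) :
    |(x₁ + (x₂ + x₂) + x₃ + x₄ - (x₅ + x₅ + x₆ + x₇)) -
      (y₁ + (y₂ + y₂) + y₃ + y₄ - (y₅ + y₅ + y₆ + y₇))| ≤ 9 * ρ := by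
  have bound : ∀ z₁ z₂ z₃ z₄ z₅ z₆ z₇ : ℝ,
      -(4 * ρ) ≤ z₁ + (z₂ + z₂) + z₃ + z₄ - (z₅ + z₅ + z₆ + z₇) -
        ρ * ((⌊z₁ / ρ⌋ + (⌊z₂ / ρ⌋ + ⌊z₂ / ρ⌋) + ⌊z₃ / ρ⌋ + ⌊z₄ / ρ⌋ -
        (⌊z₅ / ρ⌋ + ⌊z₅ / ρ⌋ + ⌊z₆ / ρ⌋ + ⌊z₇ / ρ⌋) : ℤ) : ℝ) ∧
      z₁ + (z₂ + z₂) + z₃ + z₄ - (z₅ + z₅ + z₆ + z₇) -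
        ρ * ((⌊z₁ / ρ⌋ + (⌊z₂ / ρ⌋ + ⌊z₂ / ρ⌋) + ⌊z₃ / ρ⌋ + ⌊z₄ / ρ⌋ -
        (⌊z₅ / ρ⌋ + ⌊z₅ / ρ⌋ + ⌊z₆ / ρ⌋ + ⌊z₇ / ρ⌋) : ℤ) : ℝ) ≤ 5 * ρ := by
    intro z₁ z₂ z₃ z₄ z₅ z₆ z₇
    obtain ⟨a1, b1⟩ := floor_mul_bounds hρ z₁
    obtain ⟨a2, b2⟩ := floor_mul_bounds hρ z₂
    obtain ⟨a3, b3⟩ := floor_mul_bounds hρ z₃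
    obtain ⟨a4, b4⟩ := floor_mul_bounds hρ z₄
    obtain ⟨a5, b5⟩ := floor_mul_bounds hρ z₅
    obtain ⟨a6, b6⟩ := floor_mul_bounds hρ z₆
    obtain ⟨a7, b7⟩ := floor_mul_bounds hρ z₇
    push_cast
    simp only [mul_add, mul_sub]
    constructor <;> linarith
  have hx := bound x₁ x₂ x₃ x₄ x₅ x₆ x₇
  have hy := bound y₁ y₂ y₃ y₄ y₅ y₆ y₇
  rw [h] at hx
  rw [abs_le]
  constructor <;> linarith [hx.1, hx.2, hy.1, hy.2]

lemma false_of_card_mul_le {K N Qc s₀ s₁ s₂ x τ T δ : ℝ} (hK : 100 ≤ K) (hN : 0 < N)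
    (hx : 0 < x) (hδ : δ = x ^ 2) (hτ : 0 < τ) (hT : T = (1 / K ^ 74) ^ 2) (hQ : N ≤ 2 * K * Qc)
    (hs₁ : 0 ≤ s₁)
    (h₀ : N ≤ s₀ * (K * N * √(K ^ 4 * τ ^ 2)))
    (h₁ : Qc ≤ s₁ * (K * N * √(2 * K ^ 2 * δ / τ ^ 2)))
    (h₂ : Qc ≤ s₂ * (K * N * √T)) (hNx : N * x ≤ K)
    (h : s₀ * (s₁ * s₂) ≤ K ^ 63 * N) : False := by
  have hK0 : 0 < K := by linarith
  have e0 : √(K ^ 4 * τ ^ 2) = K ^ 2 * τ := by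
    rw [show K ^ 4 * τ ^ 2 = (K ^ 2 * τ) ^ 2 by ring, Real.sqrt_sq (by positivity)]
  have e1 : √(2 * K ^ 2 * δ / τ ^ 2) ≤ 2 * K * x / τ := by
    rw [Real.sqrt_le_left (by positivity), hδ, div_pow]
    gcongr
    nlinarith [mul_pos hK0 hx]
  have e2 : √T = 1 / K ^ 74 := by rw [hT, Real.sqrt_sq (by positivity)]
  rw [e0] at h₀
  rw [e2] at h₂
  have g0 : 1 ≤ s₀ * (K ^ 3 * τ) := by
    refine le_of_mul_le_mul_right ?_ hN
    calc 1 * N = N := one_mul N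
      _ ≤ _ := h₀
      _ = _ := by ring
  have g1 : 1 ≤ s₁ * (4 * K ^ 3 * x / τ) := by
    refine le_of_mul_le_mul_right ?_ hN
    calc 1 * N = N := one_mul N
      _ ≤ 2 * K * Qc := hQ
      _ ≤ 2 * K * (s₁ * (K * N * (2 * K * x / τ))) := by
        gcongr
        exact h₁.trans (by gcongr)
      _ = _ := by ring
  have g2 : 1 ≤ s₂ * (2 * K ^ 2 * (1 / K ^ 74)) := by
    refine le_of_mul_le_mul_right ?_ hN
    calc 1 * N = N := one_mul N
      _ ≤ 2 * K * Qc := hQ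
      _ ≤ 2 * K * (s₂ * (K * N * (1 / K ^ 74))) := by gcongr
      _ = _ := by ring
  have g3 : 1 ≤ (s₀ * (K ^ 3 * τ)) * ((s₁ * (4 * K ^ 3 * x / τ)) *
      (s₂ * (2 * K ^ 2 * (1 / K ^ 74)))) :=
    one_le_mul_of_one_le_of_one_le g0 (one_le_mul_of_one_le_of_one_le g1 g2)
  have g4 : (s₀ * (K ^ 3 * τ)) * ((s₁ * (4 * K ^ 3 * x / τ)) *
      (s₂ * (2 * K ^ 2 * (1 / K ^ 74)))) = (s₀ * (s₁ * s₂)) * (8 * x / K ^ 66) := by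
    field_simp
    ring
  have g5 : (s₀ * (s₁ * s₂)) * (8 * x / K ^ 66) ≤ 8 / K ^ 2 := by
    calc _ ≤ (K ^ 63 * N) * (8 * x / K ^ 66) := by gcongr
      _ = (N * x) * (8 / K ^ 3) := by field_simp
      _ ≤ K * (8 / K ^ 3) := by gcongr
      _ = 8 / K ^ 2 := by field_simp
  have g6 : 8 / K ^ 2 < 1 := by
    rw [div_lt_one (by positivity)]; nlinarith
  linarith [g4 ▸ g3]

namespace IsAlmostRing

variable {δ K : ℝ} {P : Finset ℝ}

lemma exists_gap (h : IsAlmostRing δ δ K P) {b : ℝ} (hb : b ∈ P) {Q : Finset ℝ}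
    (hQP : Q ⊆ P) (hQc : (P.card : ℝ) ≤ 2 * K * Q.card)
    (hQ : ∀ a ∈ Q, ((dilate δ P b - dilate δ P a).card : ℝ) ≤ K ^ 6 * P.card)
    (hN : P.card * √δ ≤ K) {T : ℝ} (hT : T = (1 / K ^ 74) ^ 2) (hδT : δ ≤ T)
    {a₁ a₂ a₃ a₄ c₃ c₄ : ℝ} (h₁ : a₁ ∈ Q) (h₂ : a₂ ∈ Q) (h₃ : a₃ ∈ Q) (h₄ : a₄ ∈ Q)
    (hc₃ : c₃ = a₃) (hc₄ : c₄ = a₃ ∨ c₄ = a₄)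
    (ht : T ≤ |a₃ - a₄|) (hu : |a₁ - a₂| ≤ 3 * |a₃ - a₄|) :
    ∃ p ∈ Q, ∃ p' ∈ Q, ∃ q ∈ Q, ∃ q' ∈ Q, T ≤ |q - q'| ∧
      |2 * (a₃ - a₄) * (p' - p) - (a₁ - a₂ + (c₃ - c₄)) * (q - q')| ≤ 9 * δ := by
  classical
  by_contra hcon
  push Not at hcon
  have hK := h.le_K
  have hK0 := h.K_pos
  have hN0 := h.card_pos
  have hδ := h.delta_pos
  have hTpos : 0 < T := hδ.trans_le hδT
  set t := a₃ - a₄ with htd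
  set u := a₁ - a₂ with hud
  have ht0 : 0 < |t| := hTpos.trans_le ht
  have hv : |c₃ - c₄| ≤ |t| := by
    rcases hc₄ with rfl | rfl
    · rw [hc₃, sub_self, abs_zero]; exact ht0.le
    · rw [hc₃]
  have ht2 : |t| ≤ 2 * K := h.abs_sub_le_two_mul (hQP h₃) (hQP h₄)
  obtain ⟨S₀, hS₀, sep₀, card₀⟩ := h.exists_large_separated_subset (Finset.Subset.refl P)
    (d := K ^ 4 * |t|)
    ((hδT.trans ht).trans (le_mul_of_one_le_left ht0.le (one_le_pow₀ (by linarith))))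
  obtain ⟨S₁, hS₁, sep₁, card₁⟩ := h.exists_large_separated_subset hQP
    (d := 2 * K ^ 2 * δ / |t|) (by
      rw [le_div_iff₀ ht0]
      calc δ * |t| ≤ δ * (2 * K) := by gcongr
        _ ≤ 2 * K ^ 2 * δ := by nlinarith [mul_pos hδ hK0])
  obtain ⟨S₂, hS₂, sep₂, card₂⟩ := h.exists_large_separated_subset hQP hδT
  set B := dilate δ P b ∪ (dilate δ P a₁ ∪ (dilate δ P a₂ ∪ (dilate δ P a₃ ∪ dilate δ P a₄)))
    with hB
  have hcard : ((5 • B - 4 • B).card : ℝ) ≤ (K ^ 7) ^ (5 + 4) * P.card :=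
    h.card_nsmul_sub_nsmul hb hQ h₁ h₂ h₃ h₄ 5 4
  have mem : ∀ {a p : ℝ}, p ∈ P → ⌊a * p / δ⌋ ∈ dilate δ P a := fun hp =>
    Finset.mem_image_of_mem _ hp
  let Φ : ℝ × (ℝ × ℝ) → ℤ := fun s =>
    ⌊b * s.1 / δ⌋ + (⌊a₃ * s.2.1 / δ⌋ + ⌊a₃ * s.2.1 / δ⌋) + ⌊a₁ * s.2.2 / δ⌋ +
      ⌊c₃ * s.2.2 / δ⌋ -
      (⌊a₄ * s.2.1 / δ⌋ + ⌊a₄ * s.2.1 / δ⌋ + ⌊a₂ * s.2.2 / δ⌋ + ⌊c₄ * s.2.2 / δ⌋)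
  have hmaps : ∀ s ∈ S₀ ×ˢ (S₁ ×ˢ S₂), Φ s ∈ 5 • B - 4 • B := by
    rintro ⟨p₀, p, q⟩ hs
    simp only [Finset.mem_product] at hs
    obtain ⟨hp₀, hp, hq⟩ := hs
    have mb : ⌊b * p₀ / δ⌋ ∈ B := Finset.mem_union_left _ (mem (hS₀ hp₀))
    have m1 : ∀ {r}, r ∈ P → ⌊a₁ * r / δ⌋ ∈ B := fun hr => by
      simp only [hB, Finset.mem_union]; exact Or.inr (Or.inl (mem hr))
    have m2 : ∀ {r}, r ∈ P → ⌊a₂ * r / δ⌋ ∈ B := fun hr => by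
      simp only [hB, Finset.mem_union]; exact Or.inr (Or.inr (Or.inl (mem hr)))
    have m3 : ∀ {r}, r ∈ P → ⌊a₃ * r / δ⌋ ∈ B := fun hr => by
      simp only [hB, Finset.mem_union]; exact Or.inr (Or.inr (Or.inr (Or.inl (mem hr))))
    have m4 : ∀ {r}, r ∈ P → ⌊a₄ * r / δ⌋ ∈ B := fun hr => by
      simp only [hB, Finset.mem_union]; exact Or.inr (Or.inr (Or.inr (Or.inr (mem hr))))
    have mc3 : ∀ {r}, r ∈ P → ⌊c₃ * r / δ⌋ ∈ B := fun hr => by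
      rw [hc₃]; exact m3 hr
    have mc4 : ∀ {r}, r ∈ P → ⌊c₄ * r / δ⌋ ∈ B := fun hr => by
      rcases hc₄ with e | e <;> rw [e]
      exacts [m3 hr, m4 hr]
    have hp := hQP (hS₁ hp)
    have hq := hQP (hS₂ hq)
    have two : 2 • B = B + B := two_nsmul B
    have four : 4 • B = B + B + B + B := by
      rw [show 4 = 2 + 1 + 1 from rfl, add_nsmul, add_nsmul, two, one_nsmul]
    have five : 5 • B = B + (B + B) + B + B := by
      rw [show 5 = 1 + 2 + 1 + 1 from rfl, add_nsmul, add_nsmul, add_nsmul, two, one_nsmul]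
    rw [four, five]
    exact Finset.sub_mem_sub (Finset.add_mem_add (Finset.add_mem_add (Finset.add_mem_add mb
      (Finset.add_mem_add (m3 hp) (m3 hp))) (m1 hq)) (mc3 hq))
      (Finset.add_mem_add (Finset.add_mem_add (Finset.add_mem_add (m4 hp) (m4 hp)) (m2 hq))
        (mc4 hq))
  have key : ∀ p₀ ∈ S₀, ∀ p ∈ S₁, ∀ q ∈ S₂, ∀ p₀' ∈ S₀, ∀ p' ∈ S₁, ∀ q' ∈ S₂,
      Φ (p₀, p, q) = Φ (p₀', p', q') → p₀ = p₀' ∧ p = p' ∧ q = q' := by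
    intro p₀ hp₀ p hp q hq p₀' hp₀' p' hp' q' hq' heq
    have tot : |b * (p₀ - p₀') + (2 * t * (p - p') + (u + (c₃ - c₄)) * (q - q'))| ≤ 9 * δ := by
      have := abs_sub_le_of_floor_eq' hδ heq
      rwa [show (b * p₀ + (a₃ * p + a₃ * p) + a₁ * q + c₃ * q -
          (a₄ * p + a₄ * p + a₂ * q + c₄ * q)) -
        (b * p₀' + (a₃ * p' + a₃ * p') + a₁ * q' + c₃ * q' -
          (a₄ * p' + a₄ * p' + a₂ * q' + c₄ * q')) =
        b * (p₀ - p₀') + (2 * t * (p - p') + (u + (c₃ - c₄)) * (q - q')) by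
          rw [htd, hud]; ring] at this
    have hpp := h.abs_sub_le_two_mul (hQP (hS₁ hp)) (hQP (hS₁ hp'))
    have hqq := h.abs_sub_le_two_mul (hQP (hS₂ hq)) (hQP (hS₂ hq'))
    have hp0 : p₀ = p₀' := by
      by_contra hne
      have s1 := sep₀ p₀ hp₀ p₀' hp₀' hne
      have s2 := h.abs_le_mul_of_mem (x := p₀ - p₀') hb
      have s3 : |b * (p₀ - p₀')| ≤ 9 * δ + (2 * |t| * (2 * K) + 4 * |t| * (2 * K)) := by
        have r1 : |2 * t * (p - p')| ≤ 2 * |t| * (2 * K) := by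
          rw [abs_mul, abs_mul, abs_two]; gcongr
        have r2 : |(u + (c₃ - c₄)) * (q - q')| ≤ 4 * |t| * (2 * K) := by
          rw [abs_mul]
          have : |u + (c₃ - c₄)| ≤ 4 * |t| := by
            have := abs_add_le u (c₃ - c₄); linarith
          gcongr
        rw [abs_le] at tot r1 r2 ⊢
        constructor <;> linarith
      have s4 : K * |b * (p₀ - p₀')| ≤ K * (13 * K * |t|) := by
        refine mul_le_mul_of_nonneg_left ?_ hK0.le
        have : 9 * |t| ≤ K * |t| := by gcongr; linarith
        have : δ ≤ |t| := hδT.trans ht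
        linarith
      have s5 : K * (13 * K * |t|) ≤ K ^ 4 * |t| := by
        have h13 : 13 ≤ K ^ 2 := by nlinarith
        calc K * (13 * K * |t|) = 13 * (K ^ 2 * |t|) := by ring
          _ ≤ K ^ 2 * (K ^ 2 * |t|) := by gcongr
          _ = K ^ 4 * |t| := by ring
      linarith
    rw [hp0, sub_self, mul_zero, zero_add] at tot
    have hq0 : q = q' := by
      by_contra hne
      have s1 := sep₂ q hq q' hq' hne
      have s2 := hcon p (hS₁ hp) p' (hS₁ hp') q (hS₂ hq) q' (hS₂ hq') s1.le
      have s3 : 2 * t * (p' - p) - (u + (c₃ - c₄)) * (q - q') =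
          -(2 * t * (p - p') + (u + (c₃ - c₄)) * (q - q')) := by ring
      rw [s3, abs_neg] at s2
      linarith
    refine ⟨hp0, ?_, hq0⟩
    by_contra hne
    rw [hq0, sub_self, mul_zero, add_zero, abs_mul, abs_mul, abs_two] at tot
    have s1 := sep₁ p hp p' hp' hne
    rw [div_lt_iff₀ ht0] at s1
    have s2 : 9 * δ ≤ K ^ 2 * δ := by
      gcongr; nlinarith
    linarith
  have hle : (S₀ ×ˢ (S₁ ×ˢ S₂)).card ≤ (5 • B - 4 • B).card := by
    apply Finset.card_le_card_of_injOn Φ hmaps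
    rintro ⟨p₀, p, q⟩ hz ⟨p₀', p', q'⟩ hz' heq
    simp only [Finset.coe_product, Set.mem_prod, Finset.mem_coe] at hz hz'
    obtain ⟨r1, r2, r3⟩ := key _ hz.1 _ hz.2.1 _ hz.2.2 _ hz'.1 _ hz'.2.1 _ hz'.2.2 heq
    rw [r1, r2, r3]
  have hle' : (S₀.card : ℝ) * (S₁.card * S₂.card) ≤ K ^ 63 * P.card := by
    rw [← pow_mul] at hcard
    refine le_trans ?_ hcard
    rw [Finset.card_product, Finset.card_product] at hle
    exact_mod_cast hle
  have hsq : √|t| ^ 2 = |t| := Real.sq_sqrt ht0.le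
  exact false_of_card_mul_le hK hN0 (Real.sqrt_pos.2 hδ) (Real.sq_sqrt hδ.le).symm
    (Real.sqrt_pos.2 ht0) hT hQc (Nat.cast_nonneg _)
    (by rw [hsq]; exact card₀) (by rw [hsq]; exact card₁) card₂ hN hle'

end IsAlmostRing

lemma abs_ratio_step {t u v p q y y' σ η δ T : ℝ} (ht : T ≤ |t|) (hq : T ≤ |q|) (hT : 0 < T)
    (hσ : 9 * δ = 2 * σ * T ^ 2) (hσ0 : 0 ≤ σ) (hyy : u + v - 2 * y * t = u - y' * t)
    (hu : |u - y' * t| ≤ η * |t|) (h : |2 * t * p - (u + v) * q| ≤ 9 * δ) :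
    |p - y * q| ≤ (σ + η / 2) * |q| := by
  have ht0 : 0 < |t| := hT.trans_le ht
  have h1 : |2 * t * p - 2 * t * (y * q)| ≤ 9 * δ + η * |t| * |q| := by
    have e : 2 * t * p - 2 * t * (y * q) =
        (2 * t * p - (u + v) * q) + (u - y' * t) * q := by rw [← hyy]; ring
    rw [e]
    refine (abs_add_le _ _).trans ?_
    rw [abs_mul (u - y' * t)]
    gcongr
  have h2 : 2 * σ * T ^ 2 ≤ 2 * σ * (|t| * |q|) := by
    rw [sq]; gcongr
  rw [← mul_sub, abs_mul, abs_mul, abs_two] at h1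
  refine le_of_mul_le_mul_left ?_ (by positivity : 0 < 2 * |t|)
  calc _ ≤ _ := h1
    _ ≤ 2 * σ * (|t| * |q|) + η * |t| * |q| := by linarith
    _ = _ := by ring

namespace IsAlmostRing

variable {δ K : ℝ} {P : Finset ℝ}

lemma exists_far_pair (h : IsAlmostRing δ δ K P) {Q : Finset ℝ} (hQP : Q ⊆ P)
    (hQc : (P.card : ℝ) ≤ 2 * K * Q.card) {T : ℝ} (hT : T = (1 / K ^ 74) ^ 2) (hδT : δ ≤ T) :
    ∃ q ∈ Q, ∃ q' ∈ Q, T ≤ |q - q'| := by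
  have hK := h.le_K
  have hK0 := h.K_pos
  have hN0 := h.card_pos
  obtain ⟨S, hS, sep, card⟩ := h.exists_large_separated_subset hQP hδT
  have e2 : √T = 1 / K ^ 74 := by rw [hT, Real.sqrt_sq (by positivity)]
  rw [e2] at card
  have hS1 : 1 < S.card := by
    by_contra hc
    have hc' : (S.card : ℝ) ≤ 1 := by exact_mod_cast not_lt.1 hc
    have : (P.card : ℝ) * 1 ≤ P.card * (2 / K ^ 72) := by
      calc (P.card : ℝ) * 1 = P.card := mul_one _
        _ ≤ 2 * K * Q.card := hQc
        _ ≤ 2 * K * (1 * (K * P.card * (1 / K ^ 74))) := by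
          gcongr
          exact card.trans (by gcongr)
        _ = _ := by field_simp
    have h1 := le_of_mul_le_mul_left this hN0
    have h2 : 2 / K ^ 72 < 1 := by
      rw [div_lt_one (by positivity)]
      calc (2 : ℝ) < K := by linarith
        _ ≤ K ^ 72 := le_self_pow₀ (by linarith) (by norm_num)
    linarith
  obtain ⟨q, hq, q', hq', hne⟩ := Finset.one_lt_card.1 hS1
  exact ⟨q, hS hq, q', hS hq', (sep q hq q' hq' hne).le⟩

lemma exists_ratio_near (h : IsAlmostRing δ δ K P) {b : ℝ} (hb : b ∈ P) {Q : Finset ℝ}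
    (hQP : Q ⊆ P) (hQc : (P.card : ℝ) ≤ 2 * K * Q.card)
    (hQ : ∀ a ∈ Q, ((dilate δ P b - dilate δ P a).card : ℝ) ≤ K ^ 6 * P.card)
    (hN : P.card * √δ ≤ K) {T σ : ℝ} (hT : T = (1 / K ^ 74) ^ 2) (hδT : δ ≤ T)
    (hσ : 9 * δ = 2 * σ * T ^ 2) (hσ1 : σ ≤ 1 / 2) (n : ℕ) :
    ∀ y : ℝ, 0 ≤ y → y ≤ 1 → ∃ a₁ ∈ Q, ∃ a₂ ∈ Q, ∃ a₃ ∈ Q, ∃ a₄ ∈ Q,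
      T ≤ |a₃ - a₄| ∧ |a₁ - a₂ - y * (a₃ - a₄)| ≤ (2 * σ + (1 / 2) ^ n) * |a₃ - a₄| := by
  have hδ := h.delta_pos
  have hT0 : 0 < T := hδ.trans_le hδT
  have hσ0 : 0 ≤ σ := by
    by_contra hc
    have : 0 < T ^ 2 := by positivity
    nlinarith [mul_pos this (neg_pos.2 (not_le.1 hc))]
  induction n with
  | zero =>
    intro y hy0 hy1
    obtain ⟨q, hq, q', hq', hqq⟩ := h.exists_far_pair hQP hQc hT hδT
    refine ⟨q, hq, q, hq, q, hq, q', hq', hqq, ?_⟩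
    rw [sub_self, zero_sub, abs_neg, abs_mul, abs_of_nonneg hy0]
    gcongr
    simp only [pow_zero]
    linarith
  | succ n ih =>
    intro y hy0 hy1
    have hpow : ((1 : ℝ) / 2) ^ n ≤ 1 := pow_le_one₀ (by norm_num) (by norm_num)
    have size : ∀ {y' u t : ℝ}, 0 ≤ y' → y' ≤ 1 →
        |u - y' * t| ≤ (2 * σ + (1 / 2) ^ n) * |t| → |u| ≤ 3 * |t| := by
      intro y' u t h0 h1 h2
      have h3 : |u| ≤ |u - y' * t| + |y' * t| := by
        have := abs_add_le (u - y' * t) (y' * t); simpa using this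
      have h4 : |y' * t| ≤ 1 * |t| := by
        rw [abs_mul, abs_of_nonneg h0]; gcongr
      have h5 : (2 * σ + (1 / 2) ^ n) * |t| ≤ 2 * |t| := by
        gcongr; linarith
      linarith
    have hη : 2 * σ + (1 / 2) ^ (n + 1) = σ + (2 * σ + (1 / 2) ^ n) / 2 := by ring
    rw [hη]
    rcases le_total y (1 / 2) with hy | hy
    · obtain ⟨a₁, m₁, a₂, m₂, a₃, m₃, a₄, m₄, ht, hu⟩ := ih (2 * y) (by linarith) (by linarith)
      obtain ⟨p, hp, p', hp', q, hq, q', hq', hqq, hgap⟩ := h.exists_gap hb hQP hQc hQ hN hT hδT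
        m₁ m₂ m₃ m₄ rfl (Or.inl rfl) ht (size (by linarith) (by linarith) hu)
      exact ⟨p', hp', p, hp, q, hq, q', hq', hqq,
        abs_ratio_step ht hqq hT0 hσ hσ0 (by ring) hu hgap⟩
    · obtain ⟨a₁, m₁, a₂, m₂, a₃, m₃, a₄, m₄, ht, hu⟩ :=
        ih (2 * y - 1) (by linarith) (by linarith)
      obtain ⟨p, hp, p', hp', q, hq, q', hq', hqq, hgap⟩ := h.exists_gap hb hQP hQc hQ hN hT hδT
        m₁ m₂ m₃ m₄ rfl (Or.inr rfl) ht (size (by linarith) (by linarith) hu)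
      exact ⟨p', hp', p, hp, q, hq, q', hq', hqq,
        abs_ratio_step ht hqq hT0 hσ hσ0 (by ring) hu hgap⟩

lemma false_of_eq_scale (h : IsAlmostRing δ δ K P) (hN : P.card * √δ ≤ K)
    (hKδ : K ^ 700 * √δ ≤ 1) {n : ℕ} (hn : 2 * K < 2 ^ n * δ) (hnK : (n : ℝ) ≤ K) : False := by
  have hK := h.le_K
  have hK0 := h.K_pos
  have hK1 : 1 ≤ K := by linarith
  have hδ := h.delta_pos
  set x := √δ with hx
  have hx0 : 0 < x := Real.sqrt_pos.2 hδ
  have hδx : δ = x ^ 2 := (Real.sq_sqrt hδ.le).symm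
  have hpowx : ∀ m ≤ 700, K ^ m * x ≤ 1 := fun m hm =>
    le_trans (mul_le_mul_of_nonneg_right (pow_le_pow_right₀ hK1 hm) hx0.le) hKδ
  have hx1 : x ≤ 1 := by simpa using hpowx 0 (by norm_num)
  have hpowδ : ∀ m ≤ 700, K ^ m * δ ≤ 1 := fun m hm => by
    rw [hδx, sq, ← mul_assoc]
    exact mul_le_one₀ (hpowx m hm) hx0.le hx1
  set T : ℝ := (1 / K ^ 74) ^ 2 with hT
  have hTe : T = 1 / K ^ 148 := by rw [hT, div_pow, one_pow, ← pow_mul]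
  have hT0 : 0 < T := by positivity
  have hT1 : T ≤ 1 := by
    rw [hTe]; exact (div_le_one (by positivity)).2 (one_le_pow₀ hK1)
  have hδT : δ ≤ T := by
    rw [hTe, le_div_iff₀ (by positivity), mul_comm]
    exact hpowδ 148 (by norm_num)
  obtain ⟨b, hb, Q, hQP, hQc, hQ⟩ := h.exists_refinement
  set σ : ℝ := 9 * δ / (2 * T ^ 2) with hσ
  have hσe : σ = 9 / 2 * (K ^ 296 * δ) := by
    rw [hσ, hTe]; field_simp
  have hσ0 : 0 < σ := by positivity
  have hσ1 : σ ≤ 1 / 2 := by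
    have h1 := hpowδ 297 (by norm_num)
    have h2 : 100 * (K ^ 296 * δ) ≤ K * (K ^ 296 * δ) := by gcongr
    have h3 : K * (K ^ 296 * δ) = K ^ 297 * δ := by ring
    rw [hσe]; linarith
  obtain ⟨m, hm⟩ := exists_pow_lt_of_lt_one hσ0 (by norm_num : (1 : ℝ) / 2 < 1)
  have hV1 : δ ≤ K ^ 450 * δ := le_mul_of_one_le_left hδ.le (one_le_pow₀ hK1)
  have hL1 : 1 ≤ K ^ 299 := one_le_pow₀ hK1
  refine h.false_of_quotients_dense hb hQP hQ (T := T) (L := K ^ 299) (V := K ^ 450 * δ) (n := n)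
    hV1 hδT hL1 ?_ ?_ ?_ ?_ hnK ?_ ?_ ?_
  · rw [hTe, le_div_iff₀ (by positivity)]
    calc K ^ 299 * δ * K ^ 148 = K ^ 447 * δ := by ring
      _ ≤ 1 := hpowδ _ (by norm_num)
  · rw [hTe]
    calc 8 * K * K ^ 299 * δ / (1 / K ^ 148) = 8 * (K ^ 448 * δ) := by field_simp
      _ ≤ K * (K ^ 448 * δ) := by gcongr; linarith
      _ = K ^ 449 * δ := by ring
      _ ≤ K ^ 450 * δ := by gcongr; norm_num [hK1]
  · exact hn.trans_le (by gcongr)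
  · exact hn.trans_le (by gcongr)
  · intro y hy0 hy1
    obtain ⟨a₁, m₁, a₂, m₂, a₃, m₃, a₄, m₄, ht, hu⟩ :=
      h.exists_ratio_near hb hQP hQc hQ hN hT hδT (by rw [hσ]; field_simp) hσ1 m y hy0 hy1
    refine ⟨a₁, m₁, a₂, m₂, a₃, m₃, a₄, m₄, ht, hu.trans ?_⟩
    have ht2 := h.abs_sub_le_two_mul (hQP m₃) (hQP m₄)
    calc _ ≤ (3 * σ) * (2 * K) := by gcongr; linarith
      _ = 27 * (K ^ 297 * δ) := by rw [hσe]; ring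
      _ ≤ K ^ 2 * (K ^ 297 * δ) := by gcongr; nlinarith
      _ = _ := by ring
  · have e1 : √(K ^ 450 * δ) = K ^ 225 * x := by
      rw [Real.sqrt_mul (by positivity), show K ^ 450 = (K ^ 225) ^ 2 by ring,
        Real.sqrt_sq (by positivity)]
    have e2 : √T = 1 / K ^ 74 := by rw [hT, Real.sqrt_sq (by positivity)]
    rw [e1, e2, le_div_iff₀ (by positivity)]
    calc _ = K ^ 643 * x := by ring
      _ ≤ 1 := hpowx _ (by norm_num)
  · have e2 : √T = 1 / K ^ 74 := by rw [hT, Real.sqrt_sq (by positivity)]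
    rw [e2, le_div_iff₀ (by positivity)]
    calc _ = (P.card * x) * (K ^ 418 * x) := by rw [hδx]; ring
      _ ≤ K * (K ^ 418 * x) := by gcongr
      _ = K ^ 419 * x := by ring
      _ ≤ 1 := hpowx _ (by norm_num)

end IsAlmostRing

lemma card_image_floor_le {α : Type*} (s : Finset α) (f : α → ℝ) {R : ℝ} (hR : 0 ≤ R)
    (hf : ∀ a ∈ s, |f a| ≤ R) : ((s.image fun a => ⌊f a⌋).card : ℝ) ≤ 2 * R + 3 := by
  have hsub : s.image (fun a => ⌊f a⌋) ⊆ Finset.Icc (-⌈R⌉) ⌈R⌉ := by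
    intro z hz
    obtain ⟨a, ha, rfl⟩ := Finset.mem_image.1 hz
    have h1 := abs_le.1 (hf a ha)
    rw [Finset.mem_Icc]
    constructor
    · rw [Int.le_floor]
      push_cast
      linarith [Int.le_ceil R]
    · have h2 := (Int.floor_le (f a)).trans (h1.2.trans (Int.le_ceil R))
      exact_mod_cast h2
  have h1 := Finset.card_le_card hsub
  rw [Int.card_Icc] at h1
  have h0 : 0 ≤ ⌈R⌉ := Int.ceil_nonneg hR
  have h2 : ((⌈R⌉ + 1 - -⌈R⌉).toNat : ℝ) = 2 * ⌈R⌉ + 1 := by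
    have h3 : ((⌈R⌉ + 1 - -⌈R⌉).toNat : ℤ) = 2 * ⌈R⌉ + 1 := by
      rw [Int.toNat_of_nonneg (by linarith)]; ring
    exact_mod_cast h3
  have h4 : ((s.image fun a => ⌊f a⌋).card : ℝ) ≤ ((⌈R⌉ + 1 - -⌈R⌉).toNat : ℝ) := by
    exact_mod_cast h1
  rw [h2] at h4
  linarith [Int.ceil_lt_add_one R]

namespace IsAlmostRing

variable {ρ δ K : ℝ} {P : Finset ℝ}

/-- Pigeonholing `p + y q` into cells of length `ρ` produces a collision with `q`, `q'` far apart,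
provided that `P` does not concentrate on short intervals. -/
lemma exists_far_collision (h : IsAlmostRing ρ δ K P) {Q : Finset ℝ} (hQP : Q ⊆ P)
    (hQc : (P.card : ℝ) ≤ 2 * K * Q.card) (hρ1 : ρ ≤ 1) {T : ℝ}
    (hT : ∀ x, ((P.filter fun p => |p - x| ≤ T).card : ℝ) * K ^ 5 ≤ P.card ^ 2 * ρ)
    {y : ℝ} (hy0 : 0 ≤ y) (hy1 : y ≤ 1) :
    ∃ a₁ ∈ Q, ∃ a₂ ∈ Q, ∃ a₃ ∈ Q, ∃ a₄ ∈ Q,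
      T ≤ |a₃ - a₄| ∧ |a₁ - a₂ - y * (a₃ - a₄)| ≤ ρ := by
  classical
  by_contra hcon
  push Not at hcon
  have hK := h.le_K
  have hK0 := h.K_pos
  have hN := h.card_pos
  have hρ := h.rho_pos
  set f : ℝ × ℝ → ℝ := fun z => (z.1 + y * z.2) / ρ with hf
  have hcs := card_sq_le_card_image_mul (Q ×ˢ Q) fun z => ⌊f z⌋
  have himg : (((Q ×ˢ Q).image fun z => ⌊f z⌋).card : ℝ) ≤ 5 * K / ρ := by
    refine (card_image_floor_le _ f (R := 2 * K / ρ) (by positivity) ?_).trans ?_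
    · rintro ⟨p, q⟩ hz
      obtain ⟨hp, hq⟩ := Finset.mem_product.1 hz
      simp only [hf]
      rw [abs_div, abs_of_pos hρ]
      gcongr
      have h1 := abs_add_le p (y * q)
      have h2 : |y * q| ≤ 1 * K := by
        rw [abs_mul, abs_of_nonneg hy0]
        gcongr
        exact h.abs_bound q (hQP hq)
      linarith [h.abs_bound p (hQP hp)]
    · rw [← le_sub_iff_add_le', show 5 * K / ρ - 2 * (2 * K / ρ) = K / ρ by ring,
        le_div_iff₀ hρ]
      nlinarith
  set Z := ((Q ×ˢ Q) ×ˢ (Q ×ˢ Q)).filter fun z => ⌊f z.1⌋ = ⌊f z.2⌋ with hZ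
  have hcoll : ∀ z ∈ Z, |z.2.1 - (z.1.1 + y * (z.1.2 - z.2.2))| ≤ ρ ∧ |z.2.2 - z.1.2| ≤ T := by
    rintro ⟨⟨p, q⟩, p', q'⟩ hz
    simp only [hZ, Finset.mem_filter, Finset.mem_product] at hz
    obtain ⟨⟨⟨hp, hq⟩, hp', hq'⟩, heq⟩ := hz
    have h1 := abs_sub_lt_of_floor_eq heq
    simp only [hf] at h1
    rw [← sub_div, abs_div, abs_of_pos hρ, div_lt_one hρ] at h1
    have h2 : |p' - p - y * (q - q')| ≤ ρ := by
      rw [← abs_neg, show -(p' - p - y * (q - q')) = p + y * q - (p' + y * q') by ring]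
      exact h1.le
    refine ⟨by rwa [← sub_sub], ?_⟩
    by_contra hc
    rw [abs_sub_comm, not_le] at hc
    exact absurd h2 (not_le.2 (hcon p' hp' p hp q hq q' hq' hc.le))
  have hZc : (Z.card : ℝ) * K ^ 5 ≤ (Q.card : ℝ) ^ 2 * (2 * (P.card ^ 2 * ρ)) := by
    have hsub : Z ⊆ (Q ×ˢ Q).biUnion fun s =>
        (P.filter fun q' => |q' - s.2| ≤ T).biUnion fun q' =>
          (P.filter fun p' => |p' - (s.1 + y * (s.2 - q'))| ≤ ρ).image fun p' => (s, (p', q')) := by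
      rintro ⟨s, p', q'⟩ hz
      have hc := hcoll _ hz
      simp only [hZ, Finset.mem_filter, Finset.mem_product] at hz
      simp only [Finset.mem_biUnion, Finset.mem_image, Finset.mem_filter, Finset.mem_product]
      exact ⟨s, hz.1.1, q', ⟨hQP hz.1.2.2, hc.2⟩, p', ⟨hQP hz.1.2.1, hc.1⟩, rfl⟩
    have hb : ∀ s ∈ Q ×ˢ Q, ((((P.filter fun q' => |q' - s.2| ≤ T).biUnion fun q' =>
          (P.filter fun p' => |p' - (s.1 + y * (s.2 - q'))| ≤ ρ).image
            fun p' => (s, (p', q'))).card : ℕ) : ℝ) * K ^ 5 ≤ 2 * (P.card ^ 2 * ρ) := by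
      intro s _
      have h1 : ((((P.filter fun q' => |q' - s.2| ≤ T).biUnion fun q' =>
          (P.filter fun p' => |p' - (s.1 + y * (s.2 - q'))| ≤ ρ).image
            fun p' => (s, (p', q'))).card : ℕ) : ℝ) ≤
          ∑ q' ∈ P.filter fun q' => |q' - s.2| ≤ T, (2 : ℝ) := by
        refine (Nat.cast_le.2 Finset.card_biUnion_le).trans ?_
        rw [Nat.cast_sum]
        refine Finset.sum_le_sum fun q' _ => ?_
        refine (Nat.cast_le.2 Finset.card_image_le).trans ?_
        refine (h.card_near_le hρ.le _).trans ?_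
        rw [div_self hρ.ne']; norm_num
      rw [Finset.sum_const, nsmul_eq_mul] at h1
      calc _ ≤ _ := mul_le_mul_of_nonneg_right h1 (by positivity)
        _ = 2 * (((P.filter fun q' => |q' - s.2| ≤ T).card : ℝ) * K ^ 5) := by ring
        _ ≤ _ := by
          have := hT s.2
          linarith
    have h2 : (Z.card : ℝ) ≤ ∑ s ∈ Q ×ˢ Q, ((((P.filter fun q' => |q' - s.2| ≤ T).biUnion fun q' =>
          (P.filter fun p' => |p' - (s.1 + y * (s.2 - q'))| ≤ ρ).image
            fun p' => (s, (p', q'))).card : ℕ) : ℝ) := by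
      exact_mod_cast (Finset.card_le_card hsub).trans Finset.card_biUnion_le
    calc _ ≤ _ := mul_le_mul_of_nonneg_right h2 (by positivity)
      _ = _ := Finset.sum_mul _ _ _
      _ ≤ _ := Finset.sum_le_sum hb
      _ = _ := by
        rw [Finset.sum_const, nsmul_eq_mul, Finset.card_product]
        push_cast
        ring
  have hq0 : (0 : ℝ) < Q.card := by
    by_contra hc
    have : (Q.card : ℝ) = 0 := le_antisymm (not_lt.1 hc) (Nat.cast_nonneg _)
    rw [this, mul_zero] at hQc
    linarith
  rw [Finset.card_product, Nat.cast_mul] at hcs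
  have hZ0 : (0 : ℝ) ≤ Z.card := Nat.cast_nonneg _
  have h1 : ((Q.card : ℝ) * Q.card) ^ 2 ≤ 5 * K / ρ * Z.card :=
    hcs.trans (mul_le_mul_of_nonneg_right himg hZ0)
  generalize (Z.card : ℝ) = z at h1 hZc hZ0
  generalize (Q.card : ℝ) = m at *
  generalize (P.card : ℝ) = N at *
  have h2 : (m ^ 2) * (m ^ 2 * K ^ 5) ≤ (m ^ 2) * (10 * K * N ^ 2) := by
    calc (m ^ 2) * (m ^ 2 * K ^ 5) = (m * m) ^ 2 * K ^ 5 := by ring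
      _ ≤ (5 * K / ρ * z) * K ^ 5 := by gcongr
      _ = 5 * K / ρ * (z * K ^ 5) := by ring
      _ ≤ 5 * K / ρ * (m ^ 2 * (2 * (N ^ 2 * ρ))) := by gcongr
      _ = _ := by field_simp; ring
  have h3 := le_of_mul_le_mul_left h2 (by positivity)
  have h4 : N ^ 2 ≤ 4 * K ^ 2 * m ^ 2 := by
    calc N ^ 2 ≤ (2 * K * m) ^ 2 := by gcongr
      _ = _ := by ring
  have h5 : m ^ 2 * K ^ 5 ≤ m ^ 2 * (40 * K ^ 3) := by
    calc _ ≤ _ := h3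
      _ ≤ 10 * K * (4 * K ^ 2 * m ^ 2) := by gcongr
      _ = _ := by ring
  have h6 := le_of_mul_le_mul_left h5 (by positivity)
  have h7 : K ^ 3 * 40 < K ^ 3 * K ^ 2 := by
    gcongr; nlinarith
  linarith [show K ^ 3 * K ^ 2 = K ^ 5 by ring]

lemma false_of_small_scale (h : IsAlmostRing ρ δ K P) (hδ1 : δ ≤ 1) (hρδ : ρ ≤ δ ^ 2)
    (hN : P.card * ρ ≤ K * √δ)
    (hT : ∀ x, ((P.filter fun p => |p - x| ≤ K ^ 92 * δ).card : ℝ) * K ^ 5 ≤ P.card ^ 2 * ρ)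
    {n : ℕ} (hn : 2 * K < 2 ^ n * δ) (hnK : (n : ℝ) ≤ K) : False := by
  have hK := h.le_K
  have hK0 := h.K_pos
  have hK1 : 1 ≤ K := by linarith
  have hδ := h.delta_pos
  have hρ := h.rho_pos
  have hδT : δ ≤ K ^ 92 * δ := le_mul_of_one_le_left hδ.le (one_le_pow₀ hK1)
  obtain ⟨b, hb, Q, hQP, hQc, hQ⟩ := h.exists_refinement
  have hs : √(K ^ 92 * δ) = K ^ 46 * √δ := by
    rw [Real.sqrt_mul (by positivity), show K ^ 92 = (K ^ 46) ^ 2 by ring,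
      Real.sqrt_sq (by positivity)]
  refine h.false_of_quotients_dense hb hQP hQ (T := K ^ 92 * δ) (L := 1) (V := δ) (n := n)
    le_rfl hδT le_rfl ?_ ?_ ?_ hn hnK ?_ ?_ ?_
  · rw [one_mul]; exact h.rho_le.trans hδT
  · rw [div_le_iff₀ (by positivity)]
    calc 8 * K * 1 * ρ ≤ K * K * 1 * δ ^ 2 := by gcongr; linarith
      _ = K ^ 2 * δ ^ 2 := by ring
      _ ≤ K ^ 92 * δ ^ 2 := by
        gcongr
        norm_num
      _ = _ := by ring
  · exact hn.trans_le (by gcongr)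
  · intro y hy0 hy1
    simp only [one_mul]
    exact h.exists_far_collision hQP hQc (h.rho_le.trans hδ1) hT hy0 hy1
  · rw [hs, one_mul, mul_comm]
    have : K ^ 45 ≤ K ^ 46 := pow_le_pow_right₀ hK1 (by norm_num)
    gcongr
  · rw [hs]
    calc _ = (P.card * ρ) * K ^ 45 := by ring
      _ ≤ (K * √δ) * K ^ 45 := by gcongr
      _ = _ := by ring

end IsAlmostRing

/-- Disjoint pieces of measure at least `m` of a set `Y` are few. -/
lemma card_mul_le_volume (S : Finset ℝ) {Y : Set ℝ} (hY : MeasurableSet Y) (hfin : volume Y ≠ ∞)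
    {s m : ℝ} (hsep : ∀ x ∈ S, ∀ y ∈ S, x ≠ y → 2 * s < |x - y|)
    (hm : ∀ x ∈ S, m ≤ volume.real (Y ∩ closedBall x s)) :
    S.card * m ≤ volume.real Y := by
  have hd : (S : Set ℝ).PairwiseDisjoint fun x => Y ∩ closedBall x s := by
    intro x hx y hy hxy
    refine Disjoint.mono inter_subset_right inter_subset_right (closedBall_disjoint_closedBall ?_)
    rw [Real.dist_eq]
    linarith [hsep x hx y hy hxy]
  calc S.card * m = ∑ x ∈ S, m := by rw [Finset.sum_const, nsmul_eq_mul]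
    _ ≤ ∑ x ∈ S, volume.real (Y ∩ closedBall x s) := Finset.sum_le_sum hm
    _ = volume.real (⋃ x ∈ S, Y ∩ closedBall x s) :=
        (measureReal_biUnion_finset hd (fun x _ => hY.inter measurableSet_closedBall)
          fun x _ => measure_ne_top_of_subset inter_subset_left hfin).symm
    _ ≤ volume.real Y :=
        measureReal_mono (iUnion₂_subset fun x _ => inter_subset_left) hfin

/-- The number of grid cells of size `ρ` met by the values of `f` is controlled by the measure
of `Y`, if `Y` has large measure near each value. -/
lemma card_floor_image_mul_le {α : Type*} (s : Finset α) (f : α → ℝ) {Y : Set ℝ}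
    (hY : MeasurableSet Y) (hfin : volume Y ≠ ∞) {ρ w m : ℝ} (hρ : 0 < ρ) (hw : 0 ≤ w)
    (hm : ∀ a ∈ s, m ≤ volume.real (Y ∩ closedBall (f a) (w * ρ))) (hm0 : 0 ≤ m) :
    ((s.image fun a => ⌊f a / ρ⌋).card : ℝ) * m ≤ (4 * w + 3) * volume.real Y := by
  obtain ⟨S, hS, hsep, hcov⟩ := exists_separated_subset (s.image f)
    (d := 2 * (w * ρ)) (by positivity)
  have h1 : S.card * m ≤ volume.real Y := by
    refine card_mul_le_volume S hY hfin hsep fun x hx => ?_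
    obtain ⟨a, ha, rfl⟩ := Finset.mem_image.1 (hS hx)
    exact hm a ha
  set D := s.image fun a => ⌊f a / ρ⌋ with hD
  have h2 : (D.card : ℝ) ≤ S.card * (4 * w + 3) := by
    have hsub : D ⊆ S.biUnion fun x => D.filter fun d : ℤ => |(d : ℝ) - x / ρ| ≤ 2 * w + 1 := by
      intro d hd
      obtain ⟨a, ha, rfl⟩ := Finset.mem_image.1 hd
      obtain ⟨x, hx, hax⟩ := hcov (f a) (Finset.mem_image_of_mem _ ha)
      refine Finset.mem_biUnion.2 ⟨x, hx, Finset.mem_filter.2 ⟨hd, ?_⟩⟩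
      have e1 := Int.floor_le (f a / ρ)
      have e2 := Int.lt_floor_add_one (f a / ρ)
      have e3 : |f a / ρ - x / ρ| ≤ 2 * w := by
        rw [← sub_div, abs_div, abs_of_pos hρ, div_le_iff₀ hρ]
        linarith
      rw [abs_le] at e3 ⊢
      constructor <;> linarith [e3.1, e3.2]
    calc (D.card : ℝ) ≤ ((S.biUnion fun x =>
          D.filter fun d : ℤ => |(d : ℝ) - x / ρ| ≤ 2 * w + 1).card : ℝ) := by
          exact_mod_cast Finset.card_le_card hsub
      _ ≤ ∑ x ∈ S, ((D.filter fun d : ℤ => |(d : ℝ) - x / ρ| ≤ 2 * w + 1).card : ℝ) := by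
          exact_mod_cast Finset.card_biUnion_le
      _ ≤ ∑ x ∈ S, (4 * w + 3) := by
          apply Finset.sum_le_sum
          intro x _
          refine (card_le_of_separated _ (fun d : ℤ => (d : ℝ)) one_pos
            (by positivity : (0 : ℝ) ≤ 2 * w + 1) (x := x / ρ) ?_ ?_).trans_eq (by ring)
          · intro a _ b _ hne
            have : 1 ≤ |a - b| := Int.one_le_abs (sub_ne_zero.2 hne)
            exact_mod_cast this
          · intro a ha
            exact (Finset.mem_filter.1 ha).2
      _ = S.card * (4 * w + 3) := by rw [Finset.sum_const, nsmul_eq_mul]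
  calc (D.card : ℝ) * m ≤ S.card * (4 * w + 3) * m := mul_le_mul_of_nonneg_right h2 hm0
    _ = (4 * w + 3) * (S.card * m) := by ring
    _ ≤ _ := mul_le_mul_of_nonneg_left h1 (by positivity)

/-- A separated set near each point of which `X` has large measure is non-concentrated if `X`
is. -/
lemma card_filter_mul_le {ρ L : ℝ} {P : Finset ℝ} {X : Set ℝ}
    (hX : MeasurableSet X) (hsep : ∀ p ∈ P, ∀ q ∈ P, p ≠ q → 4 * ρ < |p - q|)
    (hPX : ∀ p ∈ P, ρ ≤ L * volume.real (X ∩ closedBall p (2 * ρ))) (hL : 0 < L) (x r : ℝ) :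
    ((P.filter fun p => |p - x| ≤ r).card : ℝ) * ρ
      ≤ L * volume.real (X ∩ closedBall x (r + 2 * ρ)) := by
  have h := card_mul_le_volume (P.filter fun p => |p - x| ≤ r)
    (hX.inter (measurableSet_closedBall (x := x) (ε := r + 2 * ρ)))
    (measure_ne_top_of_subset inter_subset_right measure_closedBall_lt_top.ne)
    (s := 2 * ρ) (m := ρ / L) (fun p hp q hq hne => by
      linarith [hsep p (Finset.mem_filter.1 hp).1 q (Finset.mem_filter.1 hq).1 hne])
    fun p hp => by
      obtain ⟨hp, hpx⟩ := Finset.mem_filter.1 hp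
      have hsub : closedBall p (2 * ρ) ⊆ closedBall x (r + 2 * ρ) := by
        apply closedBall_subset_closedBall'
        rw [Real.dist_eq]
        linarith
      rw [inter_assoc, inter_eq_right.2 hsub, div_le_iff₀' hL]
      exact hPX p hp
  rw [mul_div_assoc', div_le_iff₀' hL] at h
  exact h

/-- A separated set is an almost ring if its differences and products are captured by sets of
small measure. -/
lemma isAlmostRing_of_volume {ρ δ K : ℝ} {P : Finset ℝ} {X Y W : Set ℝ} {c m : ℕ}
    (hm : c + 8 ≤ m) (hK : 100 ≤ K) (hρ : 0 < ρ) (hρδ : ρ ≤ δ)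
    (hsep : ∀ p ∈ P, ∀ q ∈ P, p ≠ q → K * ρ < |p - q|)
    (hP1 : ∀ p ∈ P, 1 ≤ K * |p|) (hP2 : ∀ p ∈ P, |p| ≤ K)
    (hX : MeasurableSet X)
    (hY : MeasurableSet Y) (hYfin : volume Y ≠ ∞) (hW : MeasurableSet W) (hWfin : volume W ≠ ∞)
    (hPX : ∀ p ∈ P, ρ ≤ K ^ c * volume.real (X ∩ closedBall p (2 * ρ)))
    (hPY : ∀ p ∈ P, ∀ q ∈ P, ρ ≤ K ^ c * volume.real (Y ∩ closedBall (p - q) (2 * ρ)))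
    (hPW : ∀ p ∈ P, ∀ q ∈ P,
      ρ ≤ K ^ (c + 1) * volume.real (W ∩ closedBall (p * q) (2 * K * ρ)))
    (hfrost : ∀ x r : ℝ, δ ≤ r → volume.real (X ∩ closedBall x r) ≤ K ^ 2 * √δ * √r)
    (hYvol : volume.real Y ≤ K ^ 2 * √δ) (hWvol : volume.real W ≤ K ^ 2 * √δ)
    (hN : √δ ≤ K ^ 3 * P.card * ρ) : IsAlmostRing ρ δ (K ^ m) P := by
  have hK0 : 0 < K := by linarith
  have hK1 : 1 ≤ K := by linarith
  have hδ : 0 < δ := by linarith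
  have hKm : K ≤ K ^ m := le_self_pow₀ hK1 (by omega)
  have hsd : 0 < √δ := Real.sqrt_pos.2 hδ
  have hmK : ∀ {j : ℕ}, j ≤ c + 8 → K ^ j ≤ K ^ m := fun hj =>
    pow_le_pow_right₀ hK1 (hj.trans hm)
  set N := (P.card : ℝ) with hNdef
  have hN0 : 0 ≤ N := Nat.cast_nonneg _
  have hsep4 : ∀ p ∈ P, ∀ q ∈ P, p ≠ q → 4 * ρ < |p - q| := fun p hp q hq hne =>
    (mul_le_mul_of_nonneg_right (by linarith) hρ.le).trans_lt (hsep p hp q hq hne)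
  refine ⟨hK.trans hKm, hρ, hρδ, ?_, fun p hp => ?_, fun p hp => (hP2 p hp).trans hKm,
    fun a ha p hp q hq hne => ?_, fun p hp q hq hne => ?_, fun x r hr => ?_, ?_, ?_⟩
  · rw [Finset.nonempty_iff_ne_empty]
    rintro rfl
    simp only [Finset.card_empty, Nat.cast_zero] at hNdef
    rw [hNdef] at hN
    simp only [mul_zero, zero_mul] at hN
    linarith
  · exact (hP1 p hp).trans (mul_le_mul_of_nonneg_right hKm (abs_nonneg p))
  · calc ρ ≤ (K * |a|) * ρ := le_mul_of_one_le_left hρ.le (hP1 a ha)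
      _ = |a| * (K * ρ) := by ring
      _ ≤ _ := mul_le_mul_of_nonneg_left (hsep p hp q hq hne).le (abs_nonneg a)
  · linarith [hsep4 p hp q hq hne]
  · have h1 := card_filter_mul_le hX hsep4 hPX (pow_pos hK0 c) x r
    have h2 := hfrost x (r + 2 * ρ) (by linarith)
    have h3 : √(r + 2 * ρ) ≤ 2 * √r := by
      rw [Real.sqrt_le_left (by positivity), mul_pow, Real.sq_sqrt (by linarith)]
      linarith
    have hr0 : 0 ≤ √r := Real.sqrt_nonneg r
    set n := ((P.filter fun p => |p - x| ≤ r).card : ℝ)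
    have h4 : n * ρ ≤ (K ^ m * N * √r) * ρ := by
      calc n * ρ ≤ K ^ c * (K ^ 2 * √δ * (2 * √r)) := by
            refine h1.trans (mul_le_mul_of_nonneg_left (h2.trans ?_) (by positivity))
            exact mul_le_mul_of_nonneg_left h3 (by positivity)
        _ ≤ K ^ c * (K ^ 2 * √δ * (K * √r)) := by gcongr; linarith
        _ = K ^ (c + 3) * √r * √δ := by ring
        _ ≤ K ^ (c + 3) * √r * (K ^ 3 * N * ρ) :=
            mul_le_mul_of_nonneg_left hN (by positivity)
        _ = K ^ (c + 6) * (N * √r * ρ) := by ring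
        _ ≤ K ^ m * (N * √r * ρ) :=
            mul_le_mul_of_nonneg_right (hmK (by omega)) (by positivity)
        _ = _ := by ring
    exact le_of_mul_le_mul_right h4 hρ
  · have h1 := card_floor_image_mul_le (P ×ˢ P) (fun z => z.1 - z.2) hY hYfin hρ
      (w := 2) (m := ρ / K ^ c) (by norm_num) (fun z hz => by
        rw [div_le_iff₀' (by positivity)]
        exact hPY z.1 (Finset.mem_product.1 hz).1 z.2 (Finset.mem_product.1 hz).2) (by positivity)
    rw [mul_div_assoc', div_le_iff₀' (by positivity)] at h1
    refine le_of_mul_le_mul_right (h1.trans ?_) hρ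
    calc K ^ c * ((4 * 2 + 3) * volume.real Y) ≤ K ^ c * (K * (K ^ 2 * √δ)) := by
          gcongr; linarith
      _ = K ^ (c + 3) * √δ := by ring
      _ ≤ K ^ (c + 3) * (K ^ 3 * N * ρ) := mul_le_mul_of_nonneg_left hN (by positivity)
      _ = K ^ (c + 6) * (N * ρ) := by ring
      _ ≤ K ^ m * (N * ρ) := mul_le_mul_of_nonneg_right (hmK (by omega)) (by positivity)
      _ = _ := by ring
  · have h1 := card_floor_image_mul_le (P ×ˢ P) (fun z => z.1 * z.2) hW hWfin hρ
      (w := 2 * K) (m := ρ / K ^ (c + 1)) (by positivity) (fun z hz => by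
        rw [div_le_iff₀' (by positivity)]
        exact hPW z.1 (Finset.mem_product.1 hz).1 z.2 (Finset.mem_product.1 hz).2) (by positivity)
    rw [mul_div_assoc', div_le_iff₀' (by positivity)] at h1
    refine le_of_mul_le_mul_right (h1.trans ?_) hρ
    calc K ^ (c + 1) * ((4 * (2 * K) + 3) * volume.real W)
        ≤ K ^ (c + 1) * (K ^ 2 * (K ^ 2 * √δ)) := by gcongr; nlinarith
      _ = K ^ (c + 5) * √δ := by ring
      _ ≤ K ^ (c + 5) * (K ^ 3 * N * ρ) := mul_le_mul_of_nonneg_left hN (by positivity)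
      _ = K ^ (c + 8) * (N * ρ) := by ring
      _ ≤ K ^ m * (N * ρ) := mul_le_mul_of_nonneg_right (hmK (by omega)) (by positivity)
      _ = _ := by ring

/-- The upper bound for the number of points complementing `isAlmostRing_of_volume`. -/
lemma card_mul_le_of_volume {ρ δ K : ℝ} {P : Finset ℝ} {X : Set ℝ} {c : ℕ}
    (hK : 100 ≤ K) (hρ : 0 < ρ) (hρδ : ρ ≤ δ) (hδ1 : δ ≤ 1)
    (hsep : ∀ p ∈ P, ∀ q ∈ P, p ≠ q → K * ρ < |p - q|) (hP2 : ∀ p ∈ P, |p| ≤ K)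
    (hX : MeasurableSet X)
    (hPX : ∀ p ∈ P, ρ ≤ K ^ c * volume.real (X ∩ closedBall p (2 * ρ)))
    (hfrost : ∀ x r : ℝ, δ ≤ r → volume.real (X ∩ closedBall x r) ≤ K ^ 2 * √δ * √r) :
    P.card * ρ ≤ K ^ (c + 3) * √δ := by
  have hK0 : 0 < K := by linarith
  have hsep4 : ∀ p ∈ P, ∀ q ∈ P, p ≠ q → 4 * ρ < |p - q| := fun p hp q hq hne =>
    (mul_le_mul_of_nonneg_right (by linarith) hρ.le).trans_lt (hsep p hp q hq hne)
  have h1 := card_filter_mul_le hX hsep4 hPX (pow_pos hK0 c) 0 K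
  rw [Finset.filter_true_of_mem fun p hp => by simpa using hP2 p hp] at h1
  have h2 := hfrost 0 (K + 2 * ρ) (by linarith)
  have h3 : √(K + 2 * ρ) ≤ K := by
    rw [Real.sqrt_le_left hK0.le]
    nlinarith
  calc P.card * ρ ≤ K ^ c * (K ^ 2 * √δ * K) := by
        refine h1.trans (mul_le_mul_of_nonneg_left (h2.trans ?_) (by positivity))
        exact mul_le_mul_of_nonneg_left h3 (by positivity)
    _ = _ := by ring

/-- A compact set of reals violating the discretized sum-product estimate at scale `δ`, with `K`
as the admissible loss. -/
structure IsSumProductCounterexample (δ K : ℝ) (A : Set ℝ) : Prop where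
  le_K : 100 ≤ K
  delta_pos : 0 < δ
  delta_le : δ ≤ 1
  isCompact : IsCompact A
  one_le : ∀ a ∈ A, 1 ≤ K * |a|
  abs_bound : ∀ a ∈ A, |a| ≤ K
  frost : ∀ x r : ℝ, δ ≤ r → volume.real (A ∩ closedBall x r) ≤ K * √δ * √r
  volume_ge : √δ ≤ K * volume.real A
  diff : volume.real (A - A) ≤ K * √δ
  prod : volume.real (A * A) ≤ K * √δ

lemma exists_separated_net {A : Set ℝ} (hA : IsCompact A) {d : ℝ} (hd : 0 < d) :
    ∃ P : Finset ℝ, (∀ p ∈ P, p ∈ A) ∧ (∀ x ∈ P, ∀ y ∈ P, x ≠ y → d < |x - y|) ∧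
      ∀ a ∈ A, ∃ p ∈ P, |a - p| ≤ 2 * d := by
  obtain ⟨t, htA, htf, hcov⟩ := hA.finite_cover_balls hd
  obtain ⟨P, hP, hsep, hP'⟩ := exists_separated_subset htf.toFinset hd.le
  refine ⟨P, fun p hp => htA (htf.mem_toFinset.1 (hP hp)), hsep, fun a ha => ?_⟩
  obtain ⟨x, hx, hax⟩ := mem_iUnion₂.1 (hcov ha)
  obtain ⟨p, hp, hxp⟩ := hP' x (htf.mem_toFinset.2 hx)
  rw [mem_ball, Real.dist_eq] at hax
  exact ⟨p, hp, by linarith [abs_sub_le a x p]⟩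

lemma volume_le_of_cover {A : Set ℝ} {P : Finset ℝ} {s m : ℝ}
    (hcov : ∀ a ∈ A, ∃ p ∈ P, |a - p| ≤ s)
    (hm : ∀ p ∈ P, volume.real (A ∩ closedBall p s) ≤ m) :
    volume.real A ≤ P.card * m := by
  have hsub : A ⊆ ⋃ p ∈ P, A ∩ closedBall p s := fun a ha => by
    obtain ⟨p, hp, hap⟩ := hcov a ha
    exact mem_iUnion₂.2 ⟨p, hp, ha, by rwa [mem_closedBall, Real.dist_eq]⟩
  have hfin : volume (⋃ p ∈ P, A ∩ closedBall p s) ≠ ∞ :=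
    ((measure_biUnion_finset_le _ _).trans_lt (ENNReal.sum_lt_top.2 fun p _ =>
      measure_lt_top_of_subset inter_subset_right measure_closedBall_lt_top.ne)).ne
  calc volume.real A ≤ volume.real (⋃ p ∈ P, A ∩ closedBall p s) := measureReal_mono hsub hfin
    _ ≤ ∑ p ∈ P, volume.real (A ∩ closedBall p s) := measureReal_biUnion_finset_le _ _
    _ ≤ ∑ p ∈ P, m := Finset.sum_le_sum hm
    _ = P.card * m := by rw [Finset.sum_const, nsmul_eq_mul]

lemma volume_inter_closedBall_le (A : Set ℝ) (p : ℝ) {s : ℝ} (hs : 0 ≤ s) :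
    volume.real (A ∩ closedBall p s) ≤ 2 * s :=
  (measureReal_mono inter_subset_right measure_closedBall_lt_top.ne).trans_eq
    (Real.volume_real_closedBall hs)

lemma le_volume_inter_cthickening {S : Set ℝ} {x ρ s : ℝ} (hx : x ∈ S) (hρ : 0 ≤ ρ)
    (hs : ρ ≤ s) : ρ ≤ volume.real (cthickening ρ S ∩ closedBall x s) := by
  have h : volume.real (closedBall x ρ) ≤ volume.real (cthickening ρ S ∩ closedBall x s) :=
    measureReal_mono (subset_inter (closedBall_subset_cthickening hx ρ)
      (closedBall_subset_closedBall hs))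
      (measure_ne_top_of_subset inter_subset_right measure_closedBall_lt_top.ne)
  rw [Real.volume_real_closedBall hρ] at h
  linarith

lemma volume_le_volume_sub (A : Set ℝ) {x : ℝ} (hx : x ∈ A) (y r : ℝ) :
    volume.real (A ∩ closedBall y r) ≤ volume.real ((A - A) ∩ closedBall (y - x) r) := by
  have h := measure_preimage_add_right volume (-x) ((A - A) ∩ closedBall (y - x) r)
  rw [measureReal_def, measureReal_def, ← h]
  refine ENNReal.toReal_mono ?_ (measure_mono fun a ha => ⟨?_, ?_⟩)
  · rw [h]
    exact measure_ne_top_of_subset inter_subset_right measure_closedBall_lt_top.ne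
  · change a + -x ∈ A - A
    rw [← sub_eq_add_neg]
    exact sub_mem_sub ha.1 hx
  · have h2 := ha.2
    rw [mem_closedBall, Real.dist_eq] at h2 ⊢
    convert h2 using 2
    ring

lemma volume_le_volume_mul (A : Set ℝ) {q K : ℝ} (hq : q ∈ A) (hK : 0 < K) (h1 : 1 ≤ K * |q|)
    (h2 : |q| ≤ K) (p r : ℝ) :
    volume.real (A ∩ closedBall p r)
      ≤ K * volume.real ((A * A) ∩ closedBall (p * q) (K * r)) := by
  have hq0 : q ≠ 0 := by
    rintro rfl
    norm_num at h1
  have hqa : 0 < |q| := abs_pos.2 hq0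
  have h := Real.volume_preimage_mul_right hq0 ((A * A) ∩ closedBall (p * q) (K * r))
  have hfin : volume ((A * A) ∩ closedBall (p * q) (K * r)) ≠ ∞ :=
    measure_ne_top_of_subset inter_subset_right measure_closedBall_lt_top.ne
  have h3 : volume.real (A ∩ closedBall p r)
      ≤ |q⁻¹| * volume.real ((A * A) ∩ closedBall (p * q) (K * r)) := by
    rw [measureReal_def, measureReal_def, ← ENNReal.toReal_ofReal (abs_nonneg q⁻¹),
      ← ENNReal.toReal_mul, ← h]
    refine ENNReal.toReal_mono ?_ (measure_mono fun a ha => ⟨mul_mem_mul ha.1 hq, ?_⟩)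
    · rw [h]
      exact ENNReal.mul_ne_top ENNReal.ofReal_ne_top hfin
    · have h4 := ha.2
      rw [mem_closedBall, Real.dist_eq] at h4 ⊢
      rw [← sub_mul, abs_mul, mul_comm]
      exact mul_le_mul h2 h4 (abs_nonneg _) hK.le
  refine h3.trans (mul_le_mul_of_nonneg_right ?_ measureReal_nonneg)
  rw [abs_inv, inv_le_iff_one_le_mul₀ hqa]
  exact h1

lemma IsCompact.sub_self {A : Set ℝ} (hA : IsCompact A) : IsCompact (A - A) := by
  rw [sub_eq_add_neg]
  exact hA.add hA.neg

lemma eventually_volume_cthickening_le {S : Set ℝ} (hS : IsCompact S) {η : ℝ} (hη : 0 < η) :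
    ∀ᶠ r in nhds 0, volume.real (cthickening r S) ≤ volume.real S + η := by
  have h := (ENNReal.tendsto_toReal hS.measure_lt_top.ne).comp
    (tendsto_measure_cthickening_of_isCompact (μ := volume) hS)
  filter_upwards [h.eventually (gt_mem_nhds (lt_add_of_pos_right _ hη))] with r hr
  exact hr.le

namespace IsSumProductCounterexample

variable {δ K : ℝ} {A : Set ℝ}

/-- A counterexample is somewhat concentrated on some interval a bit longer than `δ`. -/
lemma exists_concentrated (h : IsSumProductCounterexample δ K A) {n : ℕ}
    (hn : 2 * K ^ 8 < 2 ^ n * δ) (hnK : (n : ℝ) ≤ K ^ 8) :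
    ∃ x, δ / K ^ 47 < volume.real (A ∩ closedBall x (K ^ 737 * δ)) := by
  by_contra! hconc
  obtain ⟨hK, hδ, hδ1, hA, hA1, hA2, hfrost, hvol, hdiff, hprod⟩ := h
  have hK0 : 0 < K := by linarith
  have hK1 : 1 ≤ K := by linarith
  have hDc : IsCompact (A - A) := hA.sub_self
  have hsδ : 0 < √δ := Real.sqrt_pos.2 hδ
  have hδs : δ ≤ √δ := Real.le_sqrt_of_sq_le (by nlinarith)
  have hKK : K + 1 ≤ K ^ 2 := by nlinarith
  set θ := δ / K ^ 47 with hθ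
  have hθ0 : 0 < θ := by positivity
  have hθδ : θ ≤ δ := div_le_self hδ.le (one_le_pow₀ hK1)
  obtain ⟨ρ, ⟨⟨⟨hXv, hYv⟩, hWv⟩, hρδ2⟩, hρ⟩ : ∃ ρ,
      (((volume.real (cthickening ρ A) ≤ volume.real A + θ ∧
        volume.real (cthickening ρ (A - A)) ≤ volume.real (A - A) + θ) ∧
        volume.real (cthickening ρ (A * A)) ≤ volume.real (A * A) + θ) ∧ ρ ≤ δ ^ 2) ∧ 0 < ρ := by
    have hev := (((eventually_volume_cthickening_le hA hθ0).and
      (eventually_volume_cthickening_le hDc hθ0)).and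
      (eventually_volume_cthickening_le (hA.mul hA) hθ0)).and
      (ge_mem_nhds (pow_pos hδ 2))
    exact ((hev.filter_mono nhdsWithin_le_nhds).and self_mem_nhdsWithin :
      ∀ᶠ r in nhdsWithin (0 : ℝ) (Ioi 0), _).exists
  have hρδ : ρ ≤ δ := by nlinarith
  obtain ⟨P, hPA, hsep, hcov⟩ := exists_separated_net hA (mul_pos hK0 hρ)
  have hXfin : volume (cthickening ρ A) ≠ ∞ := hA.cthickening.measure_lt_top.ne
  have hXball : ∀ x r, volume.real (cthickening ρ A ∩ closedBall x r)
      ≤ volume.real (A ∩ closedBall x r) + θ := by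
    intro x r
    have hsub : A ⊆ cthickening ρ A := self_subset_cthickening A
    have e1 : volume.real (cthickening ρ A \ A) ≤ θ := by
      rw [measureReal_sdiff hsub hA.measurableSet hXfin]
      linarith
    have e2 : cthickening ρ A ∩ closedBall x r
        ⊆ (A ∩ closedBall x r) ∪ (cthickening ρ A \ A) := fun y hy => by
      by_cases hyA : y ∈ A
      · exact Or.inl ⟨hyA, hy.2⟩
      · exact Or.inr ⟨hy.1, hyA⟩
    have e3 := measureReal_mono (μ := volume) e2 (measure_ne_top_of_subset
      (union_subset (inter_subset_left.trans hsub) sdiff_subset) hXfin)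
    linarith [measureReal_union_le (μ := volume) (A ∩ closedBall x r) (cthickening ρ A \ A)]
  have hXmeas : MeasurableSet (cthickening ρ A) := isClosed_cthickening.measurableSet
  have hPX : ∀ p ∈ P, ρ ≤ K ^ 0 * volume.real (cthickening ρ A ∩ closedBall p (2 * ρ)) := by
    intro p hp
    rw [pow_zero, one_mul]
    exact le_volume_inter_cthickening (hPA p hp) hρ.le (by linarith)
  have hXfrost : ∀ x r : ℝ, δ ≤ r →
      volume.real (cthickening ρ A ∩ closedBall x r) ≤ K ^ 2 * √δ * √r := by
    intro x r hr
    have e1 : θ ≤ √δ * √r := by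
      calc θ ≤ √δ * √δ := hθδ.trans_eq (Real.mul_self_sqrt hδ.le).symm
        _ ≤ _ := by gcongr
    have e2 : 0 ≤ √δ * √r := by positivity
    nlinarith [hXball x r, hfrost x r hr, mul_le_mul_of_nonneg_right hKK e2]
  have hsmall : ∀ v : ℝ, v ≤ K * √δ + θ → v ≤ K ^ 2 * √δ := by
    intro v hv
    linarith [mul_le_mul_of_nonneg_right hKK hsδ.le]
  have hN : √δ ≤ K ^ 3 * P.card * ρ := by
    have e1 := volume_le_of_cover hcov fun p _ => volume_inter_closedBall_le A p (by positivity)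
    have e2 : 0 ≤ K ^ 2 * (P.card * ρ) := by positivity
    nlinarith [mul_le_mul_of_nonneg_left e1 hK0.le]
  have hsmallδ : ∀ p ∈ P, |p| ≤ K := fun p hp => hA2 p (hPA p hp)
  have hring : IsAlmostRing ρ δ (K ^ 8) P := by
    refine isAlmostRing_of_volume (c := 0) le_rfl hK hρ hρδ hsep (fun p hp => hA1 p (hPA p hp))
      hsmallδ hXmeas isClosed_cthickening.measurableSet
      hDc.cthickening.measure_lt_top.ne isClosed_cthickening.measurableSet
      (hA.mul hA).cthickening.measure_lt_top.ne hPX (fun p hp q hq => ?_) (fun p hp q hq => ?_)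
      hXfrost (hsmall _ (by linarith)) (hsmall _ (by linarith)) hN
    · rw [pow_zero, one_mul]
      exact le_volume_inter_cthickening (sub_mem_sub (hPA p hp) (hPA q hq)) hρ.le (by linarith)
    · refine (le_volume_inter_cthickening (mul_mem_mul (hPA p hp) (hPA q hq)) hρ.le
        (s := 2 * K * ρ) (by nlinarith)).trans ?_
      exact le_mul_of_one_le_left measureReal_nonneg (one_le_pow₀ hK1)
  have hN' : P.card * ρ ≤ K ^ (0 + 3) * √δ :=
    card_mul_le_of_volume hK hρ hρδ hδ1 hsep hsmallδ hXmeas hPX hXfrost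
  refine hring.false_of_small_scale hδ1 hρδ2 (hN'.trans ?_) (fun x => ?_) hn hnK
  · exact mul_le_mul_of_nonneg_right (pow_le_pow_right₀ hK1 (by norm_num)) hsδ.le
  · have e1 := card_filter_mul_le hXmeas (fun p hp q hq hne =>
      (mul_le_mul_of_nonneg_right (by linarith : 4 ≤ K) hρ.le).trans_lt (hsep p hp q hq hne))
      hPX (pow_pos hK0 0) x ((K ^ 8) ^ 92 * δ)
    rw [pow_zero, one_mul] at e1
    have e2 : (K ^ 8) ^ 92 * δ + 2 * ρ ≤ K ^ 737 * δ := by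
      have e3 : 1 ≤ K ^ 736 := one_le_pow₀ hK1
      have e4 : δ ≤ K ^ 736 * δ := le_mul_of_one_le_left hδ.le e3
      have e5 : 100 * (K ^ 736 * δ) ≤ K * (K ^ 736 * δ) :=
        mul_le_mul_of_nonneg_right hK (by positivity)
      rw [← pow_mul, show 8 * 92 = 736 by norm_num,
        show K ^ 737 * δ = K * (K ^ 736 * δ) by rw [← mul_assoc, ← pow_succ']]
      linarith
    have e3 : volume.real (cthickening ρ A ∩ closedBall x ((K ^ 8) ^ 92 * δ + 2 * ρ)) ≤ 2 * θ := by
      have e4 : volume.real (A ∩ closedBall x ((K ^ 8) ^ 92 * δ + 2 * ρ))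
          ≤ volume.real (A ∩ closedBall x (K ^ 737 * δ)) :=
        measureReal_mono (inter_subset_inter_right _ (closedBall_subset_closedBall e2))
          (measure_ne_top_of_subset inter_subset_left hA.measure_lt_top.ne)
      linarith [hXball x ((K ^ 8) ^ 92 * δ + 2 * ρ), hconc x]
    set k := ((P.filter fun p => |p - x| ≤ (K ^ 8) ^ 92 * δ).card : ℝ)
    set N := (P.card : ℝ)
    have e6 : δ ≤ K ^ 6 * (N * ρ) ^ 2 := by
      calc δ = √δ ^ 2 := (Real.sq_sqrt hδ.le).symm
        _ ≤ (K ^ 3 * N * ρ) ^ 2 := by gcongr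
        _ = _ := by ring
    have e7 : θ * K ^ 47 = δ := div_mul_cancel₀ _ (by positivity)
    have e8 : (K ^ 6 * (k * (K ^ 8) ^ 5)) * ρ ≤ (K ^ 6 * (N ^ 2 * ρ)) * ρ := by
      calc (K ^ 6 * (k * (K ^ 8) ^ 5)) * ρ = K ^ 46 * (k * ρ) := by ring
        _ ≤ K ^ 46 * (2 * θ) := mul_le_mul_of_nonneg_left (e1.trans e3) (by positivity)
        _ = 2 * (K ^ 46 * θ) := by ring
        _ ≤ K * (K ^ 46 * θ) := mul_le_mul_of_nonneg_right (by linarith) (by positivity)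
        _ = θ * K ^ 47 := by ring
        _ ≤ K ^ 6 * (N * ρ) ^ 2 := e7.trans_le e6
        _ = _ := by ring
    exact le_of_mul_le_mul_left (le_of_mul_le_mul_right e8 hρ) (by positivity)

end IsSumProductCounterexample

namespace IsSumProductCounterexample

variable {δ K : ℝ} {A : Set ℝ}

/-- A concentrated piece of `A` forces `A` to be covered by few intervals of length `δ`. -/
lemma card_le_of_concentrated (h : IsSumProductCounterexample δ K A) {x₀ : ℝ}
    (hx₀ : δ / K ^ 47 < volume.real (A ∩ closedBall x₀ (K ^ 737 * δ))) {P : Finset ℝ}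
    (hPA : ∀ p ∈ P, p ∈ A) (hsep : ∀ x ∈ P, ∀ y ∈ P, x ≠ y → δ < |x - y|) :
    P.card * δ ≤ 5 * K ^ 785 * √δ := by
  have hK := h.le_K
  have hδ := h.delta_pos
  have hK0 : 0 < K := by linarith
  set T := K ^ 737 * δ with hT
  have hT0 : 0 < T := by positivity
  obtain ⟨S, hS, hSsep, hScov⟩ := exists_separated_subset P (d := 2 * T) (by positivity)
  have hDc : IsCompact (A - A) := h.isCompact.sub_self
  have hinj : Function.Injective fun x : ℝ => x₀ - x := sub_right_injective
  have h1 : S.card * (δ / K ^ 47) ≤ K * √δ := by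
    refine le_trans ?_ h.diff
    rw [← Finset.card_image_of_injective S hinj]
    refine card_mul_le_volume (S.image fun x => x₀ - x) hDc.measurableSet
      hDc.measure_lt_top.ne (s := T) ?_ ?_
    · intro x hx y hy hxy
      obtain ⟨a, ha, rfl⟩ := Finset.mem_image.1 hx
      obtain ⟨b, hb, rfl⟩ := Finset.mem_image.1 hy
      rw [sub_sub_sub_cancel_left, abs_sub_comm]
      exact hSsep a ha b hb fun hab => hxy (by rw [hab])
    · intro x hx
      obtain ⟨a, ha, rfl⟩ := Finset.mem_image.1 hx
      exact hx₀.le.trans (volume_le_volume_sub A (hPA a (hS ha)) x₀ T)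
  have h2 : (P.card : ℝ) ≤ S.card * (5 * K ^ 737) := by
    refine card_le_card_mul_of_cover hScov fun x _ => ?_
    refine (card_le_of_separated _ id hδ (by positivity : 0 ≤ 2 * T) (x := x) ?_ ?_).trans ?_
    · intro a ha b hb hne
      exact (hsep a (Finset.mem_filter.1 ha).1 b (Finset.mem_filter.1 hb).1 hne).le
    · intro a ha
      exact (Finset.mem_filter.1 ha).2
    · have e1 : 1 ≤ K ^ 737 := one_le_pow₀ (by linarith)
      have e2 : 2 * (2 * T) / δ = 4 * K ^ 737 := by
        rw [hT]
        field_simp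
        norm_num
      rw [e2]
      linarith
  rw [mul_div_assoc', div_le_iff₀ (by positivity)] at h1
  calc P.card * δ ≤ S.card * (5 * K ^ 737) * δ := mul_le_mul_of_nonneg_right h2 hδ.le
    _ = 5 * K ^ 737 * (S.card * δ) := by ring
    _ ≤ 5 * K ^ 737 * (K * √δ * K ^ 47) := mul_le_mul_of_nonneg_left h1 (by positivity)
    _ = _ := by ring

/-- A concentrated counterexample has many separated points around which it has large measure. -/
lemma exists_rich (h : IsSumProductCounterexample δ K A) {x₀ : ℝ}
    (hx₀ : δ / K ^ 47 < volume.real (A ∩ closedBall x₀ (K ^ 737 * δ))) :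
    ∃ P : Finset ℝ, (∀ p ∈ P, p ∈ A) ∧ (∀ x ∈ P, ∀ y ∈ P, x ≠ y → K * δ < |x - y|) ∧
      (∀ p ∈ P, δ ≤ K ^ 788 * volume.real (A ∩ closedBall p (2 * δ))) ∧
      √δ ≤ K ^ 3 * P.card * δ := by
  classical
  have hK := h.le_K
  have hδ := h.delta_pos
  have hK0 : 0 < K := by linarith
  obtain ⟨t, htA, htsep, htcov⟩ := exists_separated_net h.isCompact hδ
  have ht := h.card_le_of_concentrated hx₀ htA htsep
  set R := t.filter fun x => δ ≤ K ^ 788 * volume.real (A ∩ closedBall x (2 * δ)) with hR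
  obtain ⟨P, hP, hPsep, hPcov⟩ := exists_separated_subset R (d := K * δ) (by positivity)
  have hPR : ∀ p ∈ P, p ∈ t ∧ δ ≤ K ^ 788 * volume.real (A ∩ closedBall p (2 * δ)) :=
    fun p hp => Finset.mem_filter.1 (hP hp)
  refine ⟨P, fun p hp => htA p (hPR p hp).1, hPsep, fun p hp => (hPR p hp).2, ?_⟩
  set A₁ := {a ∈ A | ∃ x ∈ R, |a - x| ≤ 2 * δ} with hA₁
  set A₂ := {a ∈ A | ∃ x ∈ t \ R, |a - x| ≤ 2 * δ} with hA₂
  have h1 : volume.real A₁ ≤ P.card * (2 * ((K + 2) * δ)) := by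
    refine volume_le_of_cover (s := (K + 2) * δ) (fun a ha => ?_)
      fun p _ => volume_inter_closedBall_le A₁ p (by positivity)
    obtain ⟨-, x, hx, hax⟩ := ha
    obtain ⟨p, hp, hxp⟩ := hPcov x hx
    exact ⟨p, hp, by linarith [abs_sub_le a x p]⟩
  have h2 : volume.real A₂ ≤ (t \ R).card * (δ / K ^ 788) := by
    refine volume_le_of_cover (fun a ha => ha.2) fun p hp => ?_
    obtain ⟨hpt, hpR⟩ := Finset.mem_sdiff.1 hp
    have e1 : ¬ δ ≤ K ^ 788 * volume.real (A ∩ closedBall p (2 * δ)) := fun hle =>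
      hpR (Finset.mem_filter.2 ⟨hpt, hle⟩)
    rw [le_div_iff₀' (by positivity)]
    refine (mul_le_mul_of_nonneg_left ?_ (by positivity)).trans (not_le.1 e1).le
    exact measureReal_mono (inter_subset_inter_left _ fun a ha => ha.1)
      (measure_ne_top_of_subset inter_subset_right measure_closedBall_lt_top.ne)
  have h3 : volume.real A ≤ volume.real A₁ + volume.real A₂ := by
    refine (measureReal_mono (fun a ha => ?_) ?_).trans (measureReal_union_le A₁ A₂)
    · obtain ⟨x, hx, hax⟩ := htcov a ha
      by_cases hxR : x ∈ R
      · exact Or.inl ⟨ha, x, hxR, hax⟩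
      · exact Or.inr ⟨ha, x, Finset.mem_sdiff.2 ⟨hx, hxR⟩, hax⟩
    · exact measure_ne_top_of_subset (union_subset (fun a ha => ha.1) fun a ha => ha.1)
        h.isCompact.measure_lt_top.ne
  have h4 : volume.real A₂ * K ^ 3 ≤ 5 * √δ := by
    have e1 : ((t \ R).card : ℝ) ≤ t.card := by
      exact_mod_cast Finset.card_le_card Finset.sdiff_subset
    have e2 : volume.real A₂ * K ^ 3 * K ^ 785 ≤ 5 * √δ * K ^ 785 := by
      calc volume.real A₂ * K ^ 3 * K ^ 785
          ≤ (t \ R).card * (δ / K ^ 788) * K ^ 3 * K ^ 785 := by gcongr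
        _ = (t \ R).card * (δ / K ^ 788 * K ^ 788) := by ring
        _ = (t \ R).card * δ := by rw [div_mul_cancel₀ _ (by positivity)]
        _ ≤ t.card * δ := mul_le_mul_of_nonneg_right e1 hδ.le
        _ ≤ 5 * K ^ 785 * √δ := ht
        _ = _ := by ring
    exact le_of_mul_le_mul_right e2 (by positivity)
  have h5 : volume.real A₂ ≤ volume.real A / 2 := by
    have e1 : volume.real A₂ * K ^ 3 ≤ 5 * K * volume.real A := by
      linarith [h.volume_ge]
    have e2 : 5 * K * volume.real A ≤ volume.real A / 2 * K ^ 3 := by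
      have e3 : 10 * K ≤ K ^ 3 := by nlinarith [mul_pos hK0 hK0]
      nlinarith [measureReal_nonneg (μ := volume) (s := A)]
    exact le_of_mul_le_mul_right (e1.trans e2) (by positivity)
  have h6 : volume.real A ≤ 4 * (K + 2) * (P.card * δ) := by linarith
  calc √δ ≤ K * (4 * (K + 2) * (P.card * δ)) :=
        h.volume_ge.trans (mul_le_mul_of_nonneg_left h6 hK0.le)
    _ = (K * (4 * (K + 2))) * (P.card * δ) := by ring
    _ ≤ K ^ 3 * (P.card * δ) := by
        refine mul_le_mul_of_nonneg_right ?_ (by positivity)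
        nlinarith [mul_pos hK0 hK0]
    _ = _ := by ring

/-- There are no counterexamples for which the loss `K` is a small power of `1/δ`. -/
lemma elim (h : IsSumProductCounterexample δ K A) (hKδ : K ^ 557200 * √δ ≤ 1) {n : ℕ}
    (hn : 2 * K ^ 796 < 2 ^ n * δ) (hnK : (n : ℝ) ≤ K) : False := by
  have hK := h.le_K
  have hδ := h.delta_pos
  have hK0 : 0 < K := by linarith
  have hK1 : 1 ≤ K := by linarith
  have hsδ : 0 < √δ := Real.sqrt_pos.2 hδ
  have hKpow : ∀ {i j : ℕ}, i ≤ j → K ^ i ≤ K ^ j := fun hij => pow_le_pow_right₀ hK1 hij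
  have hnpow : ∀ {j : ℕ}, j ≠ 0 → (n : ℝ) ≤ K ^ j := fun hj =>
    hnK.trans (le_self_pow₀ hK1 hj)
  obtain ⟨x₀, hx₀⟩ := h.exists_concentrated
    ((mul_le_mul_of_nonneg_left (hKpow (by norm_num)) two_pos.le).trans_lt hn)
    (hnpow (by norm_num))
  obtain ⟨P, hPA, hsep, hPX, hN⟩ := h.exists_rich hx₀
  have hDc : IsCompact (A - A) := h.isCompact.sub_self
  have hMc : IsCompact (A * A) := h.isCompact.mul h.isCompact
  have hP2 : ∀ p ∈ P, |p| ≤ K := fun p hp => h.abs_bound p (hPA p hp)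
  have hKK : K * √δ ≤ K ^ 2 * √δ :=
    mul_le_mul_of_nonneg_right (le_self_pow₀ hK1 two_ne_zero) hsδ.le
  have hfrost : ∀ x r : ℝ, δ ≤ r → volume.real (A ∩ closedBall x r) ≤ K ^ 2 * √δ * √r :=
    fun x r hr => (h.frost x r hr).trans (mul_le_mul_of_nonneg_right hKK (Real.sqrt_nonneg r))
  have hring : IsAlmostRing δ δ (K ^ 796) P := by
    refine isAlmostRing_of_volume (c := 788) (by norm_num) hK hδ le_rfl hsep
      (fun p hp => h.one_le p (hPA p hp)) hP2 h.isCompact.measurableSet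
      hDc.measurableSet hDc.measure_lt_top.ne hMc.measurableSet hMc.measure_lt_top.ne
      hPX (fun p hp q hq => (hPX p hp).trans ?_) (fun p hp q hq => (hPX p hp).trans ?_) hfrost
      (h.diff.trans hKK) (h.prod.trans hKK) hN
    · exact mul_le_mul_of_nonneg_left (volume_le_volume_sub A (hPA q hq) p (2 * δ))
        (by positivity)
    · have e1 := volume_le_volume_mul A (hPA q hq) hK0 (h.one_le q (hPA q hq)) (hP2 q hq) p (2 * δ)
      rw [pow_succ K 788, mul_assoc (K ^ 788), show 2 * K * δ = K * (2 * δ) by ring]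
      exact mul_le_mul_of_nonneg_left e1 (by positivity)
  have hN' : P.card * δ ≤ K ^ (788 + 3) * √δ :=
    card_mul_le_of_volume hK hδ le_rfl h.delta_le hsep hP2 h.isCompact.measurableSet hPX hfrost
  refine hring.false_of_eq_scale ?_ ?_ hn (hnpow (by norm_num))
  · have e1 : (P.card * √δ) * √δ ≤ K ^ (788 + 3) * √δ := by
      rwa [mul_assoc, Real.mul_self_sqrt hδ.le]
    exact (le_of_mul_le_mul_right e1 hsδ).trans (hKpow (by norm_num))
  · rw [← pow_mul]
    exact hKδ

end IsSumProductCounterexample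

lemma eventually_two_mul_pow_lt (j : ℕ) :
    ∀ᶠ x : ℝ in Filter.atTop, 2 * x ^ j < 2 ^ ⌊x⌋₊ := by
  have h := (isLittleO_pow_exp_pos_mul_atTop (k := j) (Real.log_pos one_lt_two)).bound
    (by norm_num : (0 : ℝ) < 1 / 8)
  filter_upwards [h, Filter.eventually_ge_atTop 0] with x hx hx0
  rw [Real.norm_of_nonneg (by positivity), Real.norm_of_nonneg (Real.exp_nonneg _),
    ← Real.rpow_def_of_pos two_pos] at hx
  have h1 : (2 : ℝ) ^ x ≤ 2 ^ ⌊x⌋₊ * 2 := by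
    rw [← pow_succ, ← Real.rpow_natCast]
    refine Real.rpow_le_rpow_of_exponent_le one_le_two ?_
    push_cast
    exact (Nat.lt_floor_add_one x).le
  have h2 : (0 : ℝ) < 2 ^ ⌊x⌋₊ := by positivity
  linarith

/-- **Bourgain's sum–product theorem, discretized version (Theorem 2.8).** A bounded
`(δ,1/2)_1` set `A` of measure about `δ^{1/2}`, bounded away from `0`, has a large
difference set or a large product set. -/
theorem bourgain_sum_product (C : ℝ) (hC : 1 ≤ C) :
    ∃ ε : ℝ, 0 < ε ∧ ∃ δ₀ : ℝ, 0 < δ₀ ∧ ∀ δ : ℝ, 0 < δ → δ < δ₀ →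
      ∀ A : Set ℝ,
        IsCompact A →
        A ⊆ Icc (1 / C) C ∪ Icc (-C) (-(1 / C)) →
        IsDeltaRhoSet1 δ (1 / 2) C A →
        ENNReal.ofReal (δ ^ ((1 : ℝ) / 2 + ε)) ≤ volume A →
        ENNReal.ofReal (δ ^ ((1 : ℝ) / 2 - ε)) ≤
            volume {t : ℝ | ∃ a ∈ A, ∃ a' ∈ A, t = a - a'} ∨
        ENNReal.ofReal (δ ^ ((1 : ℝ) / 2 - ε)) ≤
            volume {t : ℝ | ∃ a ∈ A, ∃ a' ∈ A, t = a * a'} := by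
  obtain ⟨M, hM⟩ : ∃ M : ℕ, M = 557200 := ⟨_, rfl⟩
  have hM0 : (0 : ℝ) < M := by
    rw [hM]
    norm_num
  set ε : ℝ := 1 / (2 * M) with hε
  have hε0 : 0 < ε := by positivity
  have hεM : ε * M = 1 / 2 := by
    rw [hε]
    field_simp
  have hlarge : ∀ᶠ δ : ℝ in nhdsWithin 0 (Ioi 0),
      (100 ≤ δ ^ (-ε) ∧ C ≤ δ ^ (-ε)) ∧
        2 * (δ ^ (-ε)) ^ (796 + 2 * M) < 2 ^ ⌊δ ^ (-ε)⌋₊ :=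
    (tendsto_rpow_neg_nhdsGT_zero (neg_lt_zero.2 hε0)).eventually
      (((Filter.eventually_ge_atTop 100).and (Filter.eventually_ge_atTop C)).and
        (eventually_two_mul_pow_lt _))
  obtain ⟨δ₀, hδ₀, hsub⟩ := mem_nhdsGT_iff_exists_Ioo_subset.1 hlarge
  refine ⟨ε, hε0, min δ₀ 1, lt_min hδ₀ one_pos, fun δ hδ hδlt A hA hAC hfrost hvol => ?_⟩
  obtain ⟨⟨hK100, hCK⟩, hn⟩ := hsub ⟨hδ, hδlt.trans_le (min_le_left _ _)⟩
  obtain ⟨K, hKdef⟩ : ∃ K, K = δ ^ (-ε) := ⟨_, rfl⟩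
  rw [← hKdef] at hK100 hCK hn
  have hK0 : 0 < K := by linarith
  have hKM : K ^ M * √δ = 1 := by
    rw [hKdef, ← Real.rpow_mul_natCast hδ.le, Real.sqrt_eq_rpow, ← Real.rpow_add hδ,
      neg_mul, hεM, neg_add_cancel, Real.rpow_zero]
  have hKδ : K ^ (2 * M) * δ = 1 := by
    calc K ^ (2 * M) * δ = K ^ (2 * M) * (√δ * √δ) := by rw [Real.mul_self_sqrt hδ.le]
      _ = (K ^ M * √δ) * (K ^ M * √δ) := by ring
      _ = 1 := by rw [hKM, one_mul]
  have hupper : δ ^ ((1 : ℝ) / 2 - ε) = K * √δ := by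
    rw [hKdef, Real.sqrt_eq_rpow, ← Real.rpow_add hδ]
    congr 1
    ring
  have hlower : K * δ ^ ((1 : ℝ) / 2 + ε) = √δ := by
    rw [hKdef, Real.sqrt_eq_rpow, ← Real.rpow_add hδ]
    congr 1
    ring
  by_contra! hneg
  obtain ⟨hdiff, hprod⟩ := hneg
  have hD : {t : ℝ | ∃ a ∈ A, ∃ a' ∈ A, t = a - a'} = A - A := by
    ext t
    simp only [Set.mem_sub, eq_comm, Set.mem_ofPred_eq]
  have hP : {t : ℝ | ∃ a ∈ A, ∃ a' ∈ A, t = a * a'} = A * A := by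
    ext t
    simp only [Set.mem_mul, eq_comm, Set.mem_ofPred_eq]
  rw [hD, hupper] at hdiff
  rw [hP, hupper] at hprod
  have hKsδ : 0 ≤ K * √δ := by positivity
  have habs : ∀ a ∈ A, 1 / C ≤ |a| ∧ |a| ≤ C := fun a ha => by
    have hC0 : 0 < 1 / C := by positivity
    rcases hAC ha with ⟨h1, h2⟩ | ⟨h1, h2⟩
    · rw [abs_of_pos (by linarith)]
      exact ⟨h1, h2⟩
    · rw [abs_of_neg (by linarith)]
      exact ⟨by linarith, by linarith⟩
  have hcounter : IsSumProductCounterexample δ K A := by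
    refine ⟨hK100, hδ, hδlt.le.trans (min_le_right _ _), hA, fun a ha => ?_, fun a ha => ?_,
      fun x r hr => ?_, ?_, ENNReal.toReal_le_of_le_ofReal hKsδ hdiff.le,
      ENNReal.toReal_le_of_le_ofReal hKsδ hprod.le⟩
    · have h1 := (div_le_iff₀ (by positivity)).1 (habs a ha).1
      nlinarith [abs_nonneg a]
    · exact (habs a ha).2.trans hCK
    · have hr0 : 0 ≤ r := hδ.le.trans hr
      have h1 := hfrost x r hr
      rw [show (1 : ℝ) - 1 / 2 = 1 / 2 by norm_num, ← Real.sqrt_eq_rpow,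
        ← Real.sqrt_eq_rpow] at h1
      refine (ENNReal.toReal_le_of_le_ofReal (by positivity) h1).trans ?_
      gcongr
    · rw [← hlower]
      exact mul_le_mul_of_nonneg_left
        ((ENNReal.ofReal_le_iff_le_toReal hA.measure_lt_top.ne).1 hvol) hK0.le
  refine hcounter.elim (by rw [← hM, hKM]) (n := ⌊K⌋₊) ?_ (Nat.floor_le hK0.le)
  calc 2 * K ^ 796 = 2 * K ^ 796 * (K ^ (2 * M) * δ) := by rw [hKδ, mul_one]
    _ = 2 * K ^ (796 + 2 * M) * δ := by rw [pow_add]; ring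
    _ < 2 ^ ⌊K⌋₊ * δ := mul_lt_mul_of_pos_right hn hδ

end
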